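/- Let F ∈ ℤ[X] be a polynomial of degree D ≥ 1 which is irreducible (over ℚ) and has positive leading coefficient. Let C = {F(n) : n ∈ ℕ, n ≥ 1} ∩ {m ∈ ℕ : m ≥ 1} and let a_n = 1 if n ∈ C and a_n = 0 otherwise. For d ≥ 1 let h(d) be the number of residues r modulo d with F(r) ≡ 0 (mod d), and set g(d) = h(d)/d. Then the sequence (a_n) is regular, has level of distribution ϑ = 1/D with density g, and is locally uniform. -/

import Mathlib

open Finset Filter Real

open scoped Classical

/-- `N a x = ∑_{1 ≤ n ≤ x} a n`. -/
noncomputable def N (a : ℕ → ℝ) (x : ℝ) : ℝ := ∑ n ∈ Finset.Icc 1 ⌊x⌋₊, a n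

/-- `Nd a d x = ∑_{1 ≤ n ≤ x, d ∣ n} a n`. -/
noncomputable def Nd (a : ℕ → ℝ) (d : ℕ) (x : ℝ) : ℝ :=
  ∑ n ∈ (Finset.Icc 1 ⌊x⌋₊).filter (fun n => d ∣ n), a n

/-- `Ω n`: number of prime factors of `n` counted with multiplicity. -/
def bigOmega (n : ℕ) : ℕ := n.primeFactorsList.length

/-- Regularity: for each fixed `0 < c < 1`, `N(x^c) = o(N(x))` as `x → ∞`. -/
def Regular (a : ℕ → ℝ) : Prop :=
  ∀ c : ℝ, 0 < c → c < 1 →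
    (fun x : ℝ => N a (x ^ c)) =o[atTop] fun x : ℝ => N a x

/-- `g` is multiplicative: `g 1 = 1` and `g (m n) = g m * g n` for coprime `m, n`. -/
def MultOn (g : ℕ → ℝ) : Prop :=
  g 1 = 1 ∧ ∀ m n : ℕ, Nat.Coprime m n → g (m * n) = g m * g n

/-- `(a n)` has level of distribution `ϑ` with density `g`. -/
def HasLevel (a : ℕ → ℝ) (ϑ : ℝ) (g : ℕ → ℝ) : Prop :=
  MultOn g ∧
  (∀ d : ℕ, 1 ≤ d → g d ∈ Set.Icc (0:ℝ) 1) ∧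
  (∃ M : ℝ, ∀ x : ℝ, 2 ≤ x →
      |(∑ p ∈ (Finset.Icc 1 ⌊x⌋₊).filter Nat.Prime, g p * Real.log p) - Real.log x| ≤ M) ∧
  (∃ C : ℝ, 1 ≤ C ∧ ∃ K : ℝ, ∀ d : ℕ, 1 ≤ d → g d ≤ K * C ^ bigOmega d / d) ∧
  (∀ c : ℝ, 0 < c → c < ϑ → ∀ A : ℝ, 0 < A → ∃ K : ℝ, ∀ x : ℝ, 2 ≤ x →
      ∑ d ∈ Finset.Icc 1 ⌊x ^ c⌋₊, |Nd a d x - g d * N a x| ≤ K * N a x / Real.log x ^ A)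

/-- Local uniformity with explicit parameters `δ`, `B`, `C`. -/
def LocallyUniformWith (a : ℕ → ℝ) (δ B C : ℝ) : Prop :=
  ∃ K : ℝ, ∀ x : ℝ, 2 ≤ x → ∀ d : ℕ, 1 ≤ d → (d : ℝ) ≤ x ^ δ →
    Nd a d x ≤ K * Real.log x ^ B * C ^ bigOmega d * N a x / d

/-- Local uniformity: some parameters `δ > 0`, `B ≥ 0`, `C ≥ 1` work. -/
def LocallyUniform (a : ℕ → ℝ) : Prop :=
  ∃ δ : ℝ, 0 < δ ∧ ∃ B : ℝ, 0 ≤ B ∧ ∃ C : ℝ, 1 ≤ C ∧ LocallyUniformWith a δ B C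

/-- The `j`-th largest prime factor of `n` (with multiplicity), `1` if `n` has fewer
than `j` prime factors.  (Indexing: `j ≥ 1`.) -/
def nthPF (n j : ℕ) : ℕ :=
  (n.primeFactorsList.mergeSort (fun p q => decide (q ≤ p))).getD (j - 1) 1

/-- `log p / log n`, with the convention that this is `1` when `n = 1`. -/
noncomputable def logRatio (n p : ℕ) : ℝ := if n = 1 then 1 else Real.log p / Real.log n

/-- The largest prime factor `P⁺(n)`, with `P⁺(1) = 1`. -/
def Pplus (n : ℕ) : ℕ := n.primeFactorsList.foldr max 1

/-- The number of roots of `F` modulo `d`. -/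
def rootCount (F : Polynomial ℤ) (d : ℕ) : ℕ :=
  ((Finset.range d).filter (fun r : ℕ => (d:ℤ) ∣ F.eval (r:ℤ))).card

lemma sum_Ioc_half (f : ℕ → ℝ) (Z : ℕ) :
    ∑ m ∈ Finset.Ioc 0 Z, f m = ∑ m ∈ Finset.Ioc 0 (Z/2), f m + ∑ m ∈ Finset.Ioc (Z/2) Z, f m := by
  rw [← Finset.sum_Ioc_consecutive f (Nat.zero_le _) (Nat.div_le_self Z 2)]

lemma dyadic_pos (a : ℕ → ℝ) (ha : ∀ m, 0 ≤ a m) (c : ℝ) (hc : 0 ≤ c)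
    (h : ∀ Z : ℕ, ∑ m ∈ Finset.Ioc 0 Z, a m ≤ c * Z) (s : ℝ) (hs : 0 < s) (hs1 : s ≤ 1) :
    ∃ B : ℝ, 0 ≤ B ∧ ∀ Z : ℕ, ∑ m ∈ Finset.Ioc 0 Z, a m * (m:ℝ) ^ (s - 1) ≤ B * (Z:ℝ) ^ s := by
  have h2 : (0:ℝ) < 1 - (1/2:ℝ)^s := by
    have : (1/2:ℝ)^s < 1 := Real.rpow_lt_one (by norm_num) (by norm_num) hs
    linarith
  refine ⟨2 * c / (1 - (1/2:ℝ)^s), by positivity, ?_⟩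
  set B := 2 * c / (1 - (1/2:ℝ)^s) with hB
  have hB0 : 0 ≤ B := by positivity
  intro Z
  induction Z using Nat.strong_induction_on with
  | _ Z ih =>
    rcases Nat.eq_zero_or_pos Z with rfl | hZ
    · simp; positivity
    have hZ' : (0:ℝ) < Z := by exact_mod_cast hZ
    rw [sum_Ioc_half]
    have h1 := ih (Z/2) (Nat.div_lt_self hZ (by norm_num))
    have h3 : B * ((Z/2 : ℕ):ℝ)^s ≤ B * ((1/2:ℝ)^s * (Z:ℝ)^s) := by
      rw [← Real.mul_rpow (by norm_num) hZ'.le]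
      gcongr
      have := @Nat.cast_div_le ℝ _ _ _ Z 2
      push_cast at this; linarith
    have h4 : ∑ m ∈ Finset.Ioc (Z/2) Z, a m * (m:ℝ) ^ (s - 1) ≤ 2 * c * (Z:ℝ)^s := by
      calc ∑ m ∈ Finset.Ioc (Z/2) Z, a m * (m:ℝ) ^ (s - 1)
          ≤ ∑ m ∈ Finset.Ioc (Z/2) Z, a m * ((Z:ℝ)/2) ^ (s - 1) := by
            apply Finset.sum_le_sum
            intro m hm
            apply mul_le_mul_of_nonneg_left _ (ha m)
            apply Real.rpow_le_rpow_of_nonpos (by positivity) _ (by linarith)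
            rw [Finset.mem_Ioc] at hm
            have : Z ≤ 2 * m := by omega
            have : (Z:ℝ) ≤ 2 * m := by exact_mod_cast this
            linarith
        _ = (∑ m ∈ Finset.Ioc (Z/2) Z, a m) * ((Z:ℝ)/2) ^ (s - 1) := by rw [Finset.sum_mul]
        _ ≤ (c * Z) * ((Z:ℝ)/2) ^ (s - 1) := by
            gcongr
            refine le_trans ?_ (h Z)
            apply Finset.sum_le_sum_of_subset_of_nonneg
            · exact Finset.Ioc_subset_Ioc_left (Nat.zero_le _)
            · intros; exact ha _
        _ = 2 * c * ((Z:ℝ)/2)^s := by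
            rw [Real.rpow_sub_one (by positivity)]
            field_simp
        _ ≤ 2 * c * (Z:ℝ)^s := by gcongr; linarith
    have h5 : B * (1 - (1/2:ℝ)^s) = 2 * c := by rw [hB]; field_simp
    nlinarith [Real.rpow_pos_of_pos hZ' s]

lemma dyadic_neg (a : ℕ → ℝ) (ha : ∀ m, 0 ≤ a m) (c : ℝ) (hc : 0 ≤ c)
    (h : ∀ Z : ℕ, ∑ m ∈ Finset.Ioc 0 Z, a m ≤ c * √Z) :
    ∃ B : ℝ, ∀ Z : ℕ, ∑ m ∈ Finset.Ioc 0 Z, a m / m ≤ B := by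
  have key : ∀ Z : ℕ, 1 ≤ Z → ∑ m ∈ Finset.Ioc 0 Z, a m / m ≤ 6 * c * (2 - 1 / √Z) := by
    intro Z
    induction Z using Nat.strong_induction_on with
    | _ Z ih =>
      intro hZ
      rcases hZ.eq_or_lt with rfl | hZ
      · have := h 1
        simp at this ⊢
        linarith
      have hZ' : (0:ℝ) < Z := by positivity
      rw [sum_Ioc_half]
      have h1 := ih (Z/2) (Nat.div_lt_self (by omega) (by norm_num)) (by omega)
      have hZ2 : (0:ℝ) < ((Z/2:ℕ):ℝ) := by
        have : 0 < Z/2 := by omega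
        exact_mod_cast this
      have hs : 0 < √(Z:ℝ) := Real.sqrt_pos.mpr hZ'
      have h3 : √2 / √Z ≤ 1 / √((Z/2:ℕ):ℝ) := by
        rw [div_le_div_iff₀ hs (Real.sqrt_pos.mpr hZ2), one_mul, ← Real.sqrt_mul (by norm_num)]
        apply Real.sqrt_le_sqrt
        have := @Nat.cast_div_le ℝ _ _ _ Z 2
        push_cast at this; linarith
      have h4 : ∑ m ∈ Finset.Ioc (Z/2) Z, a m / m ≤ 2 * c / √Z := by
        calc ∑ m ∈ Finset.Ioc (Z/2) Z, a m / m
            ≤ ∑ m ∈ Finset.Ioc (Z/2) Z, a m / ((Z:ℝ)/2) := by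
              apply Finset.sum_le_sum
              intro m hm
              rw [Finset.mem_Ioc] at hm
              have : Z ≤ 2 * m := by omega
              have : (Z:ℝ) ≤ 2 * m := by exact_mod_cast this
              apply div_le_div_of_nonneg_left (ha m) (by positivity) (by linarith)
          _ = (∑ m ∈ Finset.Ioc (Z/2) Z, a m) / ((Z:ℝ)/2) := by rw [Finset.sum_div]
          _ ≤ (c * √Z) / ((Z:ℝ)/2) := by
              gcongr
              refine le_trans ?_ (h Z)
              apply Finset.sum_le_sum_of_subset_of_nonneg
              · exact Finset.Ioc_subset_Ioc_left (Nat.zero_le _)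
              · intros; exact ha _
          _ = 2 * c / √Z := by
              have := Real.mul_self_sqrt hZ'.le
              field_simp
              nlinarith
      have h5 : (1.4:ℝ) ≤ √2 := Real.le_sqrt_of_sq_le (by norm_num)
      have h6 : 2 * c / √Z ≤ 6 * c * ((√2 - 1) / √Z) := by
        rw [mul_div_assoc']
        apply div_le_div_of_nonneg_right _ hs.le
        nlinarith
      have h7 : 6 * c * (2 - 1 / √((Z/2:ℕ):ℝ)) ≤ 6 * c * (2 - √2 / √Z) := by gcongr
      have : (√2 - 1) / √Z = √2/√Z - 1/√Z := by ring
      rw [this] at h6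
      linarith
  refine ⟨12 * c, fun Z => ?_⟩
  rcases Nat.eq_zero_or_pos Z with rfl | hZ
  · simp; positivity
  refine (key Z hZ).trans ?_
  have : 0 ≤ 1 / √(Z:ℝ) := by positivity
  nlinarith

/-- the analytic core -/
lemma analytic_core (W : ℕ → ℝ) (hW0 : ∀ m, 0 ≤ W m) (C : ℝ) (hC : 0 ≤ C)
    (hWL : ∀ m, W m ≤ C * ArithmeticFunction.vonMangoldt m)
    (n : ℕ) (hn : 1 ≤ n) (L : ℕ) (hL : 1 ≤ L)
    (hmain : ∀ Y : ℕ, 1 ≤ Y →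
      |∑ m ∈ Finset.Ioc 0 ((L * Y)^n), W m * ((Y:ℝ)^n / m) - (Y:ℝ)^n * (n * Real.log Y)| ≤
        C * (Y:ℝ)^n + C * (Y:ℝ)^(n-1) *
          ∑ m ∈ Finset.Ioc 0 ((L * Y)^n), W m * (m:ℝ)^((1:ℝ)/n - 1)) :
    ∃ M : ℝ, ∀ x : ℝ, 2 ≤ x →
      |∑ p ∈ (Finset.Icc 1 ⌊x⌋₊).filter Nat.Prime, W p / p - Real.log x| ≤ M := by
  have hn0 : (0:ℝ) < n := by exact_mod_cast hn
  have hpsi : ∀ Z : ℕ, ∑ m ∈ Finset.Ioc 0 Z, ArithmeticFunction.vonMangoldt m ≤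
      (Real.log 4 + 4) * Z := by
    intro Z
    have := Chebyshev.psi_le_const_mul_self (x := Z) (by positivity)
    rwa [Chebyshev.psi, Nat.floor_natCast] at this
  have hlog4 : 0 ≤ Real.log 4 + 4 := by have := Real.log_nonneg (x := 4) (by norm_num); linarith
  obtain ⟨B1, hB1, hdy⟩ := dyadic_pos _ (fun m => ArithmeticFunction.vonMangoldt_nonneg (n := m)) _
    hlog4 hpsi ((1:ℝ)/n) (by positivity) (by rw [div_le_one hn0]; exact_mod_cast hn)
  obtain ⟨C2, hC2⟩ := Chebyshev.psi_sub_theta_le_mul_sqrt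
  obtain ⟨B2, hB2⟩ := dyadic_neg (fun m => if m.Prime then 0 else ArithmeticFunction.vonMangoldt m)
    (fun m => by positivity)
    (|C2|) (abs_nonneg _) (by
      intro Z
      have h1 := hC2 Z
      rw [Chebyshev.psi_sub_theta_eq_sum_not_prime, Nat.floor_natCast] at h1
      have : ∑ m ∈ Finset.Ioc 0 Z, (if m.Prime then 0 else ArithmeticFunction.vonMangoldt m)
        = ∑ n ∈ Finset.Ioc 0 Z with ¬n.Prime, ArithmeticFunction.vonMangoldt n := by
        rw [Finset.sum_filter]
        apply Finset.sum_congr rfl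
        intro m _
        by_cases hm : m.Prime <;> simp [hm]
      rw [this]
      refine h1.trans ?_
      gcongr
      exact le_abs_self _)
  -- Step 1 : full sum
  have step1 : ∀ Y : ℕ, 1 ≤ Y →
      |∑ m ∈ Finset.Ioc 0 ((L * Y)^n), W m / m - n * Real.log Y| ≤ C + C * (C * (B1 * L)) := by
    intro Y hY
    have hYp : (0:ℝ) < Y := by exact_mod_cast hY
    have hYn : (0:ℝ) < (Y:ℝ)^n := by positivity
    have h1 := hmain Y hY
    have h2 : ∑ m ∈ Finset.Ioc 0 ((L * Y)^n), W m * (m:ℝ)^((1:ℝ)/n - 1) ≤ C * (B1 * (L * Y)) := by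
      calc ∑ m ∈ Finset.Ioc 0 ((L * Y)^n), W m * (m:ℝ)^((1:ℝ)/n - 1)
          ≤ ∑ m ∈ Finset.Ioc 0 ((L * Y)^n), C *
            (ArithmeticFunction.vonMangoldt m * (m:ℝ)^((1:ℝ)/n - 1)) := by
            apply Finset.sum_le_sum
            intro m _
            rw [← mul_assoc]
            apply mul_le_mul_of_nonneg_right (hWL m) (by positivity)
        _ ≤ C * (B1 * (((L*Y)^n : ℕ):ℝ)^((1:ℝ)/n)) := by
            rw [← Finset.mul_sum]
            gcongr
            exact hdy _
        _ = C * (B1 * (L * Y)) := by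
            push_cast
            rw [← Real.rpow_natCast, ← Real.rpow_mul (by positivity)]
            rw [mul_one_div_cancel hn0.ne', Real.rpow_one]
    have h3 : ∑ m ∈ Finset.Ioc 0 ((L * Y)^n), W m * ((Y:ℝ)^n / m)
        = (Y:ℝ)^n * ∑ m ∈ Finset.Ioc 0 ((L * Y)^n), W m / m := by
      rw [Finset.mul_sum]; apply Finset.sum_congr rfl; intros; ring
    rw [h3, ← mul_sub, abs_mul, abs_of_pos hYn] at h1
    have h4 : C * (Y:ℝ)^(n-1) *
          ∑ m ∈ Finset.Ioc 0 ((L * Y)^n), W m * (m:ℝ)^((1:ℝ)/n - 1) ≤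
          (Y:ℝ)^n * (C * (C * (B1 * L))) := by
      calc _ ≤ C * (Y:ℝ)^(n-1) * (C * (B1 * (L * Y))) := by gcongr
        _ = ((Y:ℝ)^(n-1) * Y) * (C * (C * (B1 * L))) := by ring
        _ = _ := by rw [pow_sub_one_mul (by omega)]
    refine le_of_mul_le_mul_left ?_ hYn
    linarith
  -- Step 2
  refine ⟨(C + C * (C * (B1 * L))) + n * Real.log 2 + C * B2 +
    C * ((Real.log 4 + 4) * (2 * L)^n), fun x hx => ?_⟩
  set Y := ⌈x^((1:ℝ)/n)⌉₊ with hYdef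
  have hx0 : (0:ℝ) < x := by linarith
  have hr1 : 1 ≤ x^((1:ℝ)/n) := Real.one_le_rpow (by linarith) (by positivity)
  have hrpow : (x^((1:ℝ)/n))^n = x := by
    rw [← Real.rpow_natCast, ← Real.rpow_mul hx0.le, one_div_mul_cancel hn0.ne', Real.rpow_one]
  have hY1 : x^((1:ℝ)/n) ≤ Y := Nat.le_ceil _
  have hY2 : (Y:ℝ) ≤ 2 * x^((1:ℝ)/n) := by
    have := Nat.ceil_lt_add_one (a := x^((1:ℝ)/n)) (by linarith)
    linarith
  have hYpos : 1 ≤ Y := by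
    have : (1:ℝ) ≤ Y := by linarith
    exact_mod_cast this
  set Z := (L * Y)^n with hZdef
  have hxZ : x ≤ Z := by
    rw [hZdef]; push_cast
    calc x = (x^((1:ℝ)/n))^n := hrpow.symm
      _ ≤ ((1:ℝ) * Y)^n := by gcongr; linarith
      _ ≤ (L * Y)^n := by gcongr; exact_mod_cast hL
  have hZx : (Z:ℝ) ≤ (2*L)^n * x := by
    rw [hZdef]; push_cast
    calc ((L:ℝ) * Y)^n ≤ (L * (2 * x^((1:ℝ)/n)))^n := by gcongr
      _ = (2*L)^n * (x^((1:ℝ)/n))^n := by rw [← mul_pow]; ring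
      _ = _ := by rw [hrpow]
  have hlogx : Real.log x = n * Real.log (x^((1:ℝ)/n)) := by
    rw [Real.log_rpow hx0]; field_simp
  have hlogY1 : Real.log x ≤ n * Real.log Y := by
    rw [hlogx]
    gcongr
  have hlogY2 : n * Real.log Y ≤ Real.log x + n * Real.log 2 := by
    rw [hlogx, ← mul_add, add_comm, ← Real.log_mul (by norm_num) (by positivity)]
    gcongr
  have hs1 := step1 Y hYpos
  rw [← hZdef] at hs1
  have hsplit : ∑ m ∈ Finset.Ioc 0 Z, W m / m =
      ∑ p ∈ (Finset.Icc 1 ⌊x⌋₊).filter Nat.Prime, W p / p +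
      (∑ m ∈ (Finset.Ioc 0 ⌊x⌋₊).filter (fun m => ¬ m.Prime), W m / m +
        ∑ m ∈ Finset.Ioc ⌊x⌋₊ Z, W m / m) := by
    rw [← add_assoc, ← Finset.sum_Ioc_consecutive _ (Nat.zero_le ⌊x⌋₊) (Nat.floor_le_of_le hxZ)]
    congr 1
    exact (Finset.sum_filter_add_sum_filter_not _ _ _).symm
  have hE1 : ∑ m ∈ (Finset.Ioc 0 ⌊x⌋₊).filter (fun m => ¬ m.Prime), W m / m ≤ C * B2 := by
    refine le_trans ?_ (mul_le_mul_of_nonneg_left (hB2 ⌊x⌋₊) hC)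
    rw [Finset.mul_sum, Finset.sum_filter]
    apply Finset.sum_le_sum
    intro m _
    by_cases hm : m.Prime
    · simp [hm]
    · simp only [hm, not_false_eq_true, if_true, if_false]
      rw [mul_div_assoc']
      gcongr
      exact hWL m
  have hE10 : 0 ≤ ∑ m ∈ (Finset.Ioc 0 ⌊x⌋₊).filter (fun m => ¬ m.Prime), W m / m :=
    Finset.sum_nonneg (fun m _ => div_nonneg (hW0 m) (by positivity))
  have hE20 : 0 ≤ ∑ m ∈ Finset.Ioc ⌊x⌋₊ Z, W m / m :=
    Finset.sum_nonneg (fun m _ => div_nonneg (hW0 m) (by positivity))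
  have hE2 : ∑ m ∈ Finset.Ioc ⌊x⌋₊ Z, W m / m ≤ C * ((Real.log 4 + 4) * (2 * L)^n) := by
    calc ∑ m ∈ Finset.Ioc ⌊x⌋₊ Z, W m / m
        ≤ ∑ m ∈ Finset.Ioc ⌊x⌋₊ Z, (C / x) * ArithmeticFunction.vonMangoldt m := by
          apply Finset.sum_le_sum
          intro m hm
          rw [Finset.mem_Ioc] at hm
          have hmx : x ≤ m := (Nat.lt_of_floor_lt hm.1).le
          calc W m / m ≤ W m / x := div_le_div_of_nonneg_left (hW0 m) hx0 hmx
            _ ≤ (C * ArithmeticFunction.vonMangoldt m) / x := by gcongr; exact hWL m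
            _ = _ := by ring
      _ = (C / x) * ∑ m ∈ Finset.Ioc ⌊x⌋₊ Z, ArithmeticFunction.vonMangoldt m := by
          rw [Finset.mul_sum]
      _ ≤ (C / x) * ((Real.log 4 + 4) * Z) := by
          gcongr
          refine le_trans ?_ (hpsi Z)
          apply Finset.sum_le_sum_of_subset_of_nonneg
          · exact Finset.Ioc_subset_Ioc_left (Nat.zero_le _)
          · intros; exact ArithmeticFunction.vonMangoldt_nonneg
      _ ≤ (C / x) * ((Real.log 4 + 4) * ((2*L)^n * x)) := by gcongr
      _ = _ := by field_simp
  rw [abs_le] at hs1 ⊢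
  have hl2 : 0 ≤ n * Real.log 2 := by positivity
  have hQ : 0 ≤ C * (C * (B1 * L)) := by positivity
  constructor <;> linarith [hs1.1, hs1.2]

section boxes
variable {O : Type*} [CommRing O] [IsDedekindDomain O] [Module.Free ℤ O] [Module.Finite ℤ O]
  {ι : Type*} [Fintype ι]

lemma box_count (b : Module.Basis ι ℤ O) (I : Ideal O) (hI : I ≠ ⊥) (w : ℕ)
    (hw : ∀ x : O, ∃ y ∈ I, ∀ i, |b.repr (x - y) i| ≤ w) (s : O) (Y : ℕ) :
    Ideal.absNorm I * ((Fintype.piFinset fun _ : ι => Finset.Ico (0:ℤ) Y).filter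
      (fun a => s + b.equivFun.symm a ∈ I)).card ≤ (Y + 2 * w) ^ Fintype.card ι ∧
    (Y - 2 * w) ^ Fintype.card ι ≤
    Ideal.absNorm I * ((Fintype.piFinset fun _ : ι => Finset.Ico (0:ℤ) Y).filter
      (fun a => s + b.equivFun.symm a ∈ I)).card := by
  have hfin : Finite (O ⧸ I) := by
    rw [← Ideal.absNorm_ne_zero_iff]
    rwa [Ne, Ideal.absNorm_eq_zero_iff]
  have : Fintype (O ⧸ I) := Fintype.ofFinite _
  have hR : ∀ q : O ⧸ I, ∃ r : ι → ℤ, (∀ i, |r i| ≤ w) ∧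
      Ideal.Quotient.mk I (b.equivFun.symm r) = q := by
    intro q
    obtain ⟨x, rfl⟩ := Ideal.Quotient.mk_surjective q
    obtain ⟨y, hy, h⟩ := hw x
    refine ⟨b.equivFun (x - y), fun i => by simpa using h i, ?_⟩
    rw [LinearEquiv.symm_apply_apply, map_sub, Ideal.Quotient.eq_zero_iff_mem.mpr hy, sub_zero]
  choose R hR1 hR2 using hR
  set A := (Fintype.piFinset fun _ : ι => Finset.Ico (0:ℤ) Y).filter
      (fun a => s + b.equivFun.symm a ∈ I) with hA
  have hN : Ideal.absNorm I = Fintype.card (O ⧸ I) := by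
    rw [Ideal.absNorm_apply, Submodule.cardQuot_apply, Nat.card_eq_fintype_card]
  have hprod : Ideal.absNorm I * A.card = ((Finset.univ : Finset (O ⧸ I)) ×ˢ A).card := by
    rw [Finset.card_product, hN, Finset.card_univ]
  rw [hprod]
  constructor
  · have h1 : (Fintype.piFinset fun _ : ι => Finset.Ico (-(w:ℤ)) (Y + w)).card
        = (Y + 2 * w) ^ Fintype.card ι := by
      rw [Fintype.card_piFinset, Finset.prod_const, Int.card_Ico, Finset.card_univ]
      congr 1; omega
    rw [← h1]
    apply Finset.card_le_card_of_injOn (fun qa => qa.2 + R qa.1)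
    · rintro ⟨q, a⟩ hqa
      simp only [Finset.coe_product, Set.mem_prod, Finset.mem_coe, hA, Finset.mem_filter,
        Fintype.mem_piFinset, Finset.mem_Ico] at hqa ⊢
      intro i
      have := hqa.2.1 i
      have := abs_le.mp (hR1 q i)
      simp only [Pi.add_apply]
      omega
    · rintro ⟨q, a⟩ hqa ⟨q', a'⟩ hqa' heq
      simp only [Finset.coe_product, Set.mem_prod, Finset.mem_coe, hA, Finset.mem_filter] at hqa hqa'
      have key : ∀ (q : O ⧸ I) (a : ι → ℤ), s + b.equivFun.symm a ∈ I →
          Ideal.Quotient.mk I (s + b.equivFun.symm (a + R q)) = q := by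
        intro q a ha
        rw [map_add b.equivFun.symm, ← add_assoc, map_add, hR2, Ideal.Quotient.eq_zero_iff_mem.mpr ha, zero_add]
      have e1 := key q a hqa.2.2
      have e2 := key q' a' hqa'.2.2
      simp only at heq
      rw [heq] at e1
      have hq : q = q' := e1.symm.trans e2
      subst hq
      simpa using heq
  · have h1 : (Fintype.piFinset fun _ : ι => Finset.Ico (w:ℤ) (Y - w)).card
        = (Y - 2 * w) ^ Fintype.card ι := by
      rw [Fintype.card_piFinset, Finset.prod_const, Int.card_Ico, Finset.card_univ]
      congr 1; omega
    rw [← h1]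
    apply Finset.card_le_card_of_injOn (fun c =>
      (Ideal.Quotient.mk I (s + b.equivFun.symm c),
        c - R (Ideal.Quotient.mk I (s + b.equivFun.symm c))))
    · intro c hc
      simp only [Finset.coe_product, Set.mem_prod, Finset.mem_coe, hA, Finset.mem_filter,
        Fintype.mem_piFinset, Finset.mem_Ico, Finset.mem_univ, true_and] at hc ⊢
      refine ⟨fun i => ?_, ?_⟩
      · have := hc i
        have := abs_le.mp (hR1 (Ideal.Quotient.mk I (s + b.equivFun.symm c)) i)
        simp only [Pi.sub_apply]
        omega
      · rw [← Ideal.Quotient.eq_zero_iff_mem, map_sub b.equivFun.symm, ← add_sub_assoc, map_sub, hR2, sub_self]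
    · intro c _ c' _ heq
      simp only [Prod.mk.injEq] at heq
      rw [heq.1] at heq
      simpa using heq.2

lemma small_reps (b : Module.Basis ι ℤ O) [Nonempty ι] : ∃ C : ℕ, ∀ I : Ideal O, I ≠ ⊥ → ∀ t : ℕ,
    Ideal.absNorm I < (t + 1) ^ Fintype.card ι →
    ∀ x : O, ∃ y ∈ I, ∀ i, |b.repr (x - y) i| ≤ (C * t : ℕ) := by
  refine ⟨(∑ k, ∑ i, ∑ j, |b.repr (b k * b i) j|).toNat, ?_⟩
  intro I hI t ht x
  set S := ∑ k, ∑ i, ∑ j, |b.repr (b k * b i) j| with hS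
  have hS0 : 0 ≤ S := by positivity
  have hfin : Finite (O ⧸ I) := by
    rw [← Ideal.absNorm_ne_zero_iff]
    rwa [Ne, Ideal.absNorm_eq_zero_iff]
  have : Fintype (O ⧸ I) := Fintype.ofFinite _
  have hN : Ideal.absNorm I = Fintype.card (O ⧸ I) := by
    rw [Ideal.absNorm_apply, Submodule.cardQuot_apply, Nat.card_eq_fintype_card]
  -- pigeonhole
  obtain ⟨a, ha, a', ha', hne, heq⟩ := Finset.exists_ne_map_eq_of_card_lt_of_maps_to
    (s := Fintype.piFinset fun _ : ι => Finset.Ico (0:ℤ) (t+1)) (t := (Finset.univ : Finset (O ⧸ I)))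
    (f := fun a => Ideal.Quotient.mk I (b.equivFun.symm a)) (by
      rw [Fintype.card_piFinset, Finset.prod_const, Int.card_Ico, Finset.card_univ, ← hN,
        Finset.card_univ]
      convert ht using 2
      omega) (fun _ _ => by simp)
  set β := b.equivFun.symm (a - a') with hβ
  have hβI : β ∈ I := by
    rw [hβ, map_sub, ← Ideal.Quotient.eq]; exact heq
  have hβ0 : β ≠ 0 := by
    rw [hβ]
    intro h
    rw [LinearEquiv.map_eq_zero_iff, sub_eq_zero] at h
    exact hne h
  have hβc : ∀ i, |(a - a') i| ≤ t := by
    intro i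
    simp only [Fintype.mem_piFinset, Finset.mem_Ico] at ha ha'
    have := ha i; have := ha' i
    simp only [Pi.sub_apply]
    rw [abs_le]; omega
  -- integer multiple
  set m : ℕ := Ideal.absNorm (Ideal.span {β}) with hm
  have hm0 : m ≠ 0 := by
    rw [hm, Ne, Ideal.absNorm_eq_zero_iff]
    simpa using hβ0
  obtain ⟨γ, hγ⟩ := Ideal.mem_span_singleton'.mp (Ideal.absNorm_mem (Ideal.span {β}))
  rw [← hm] at hγ
  set e := b.equivFun (x * γ) with he
  set f : ι → ℤ := fun i => e i / m
  set r : ι → ℤ := fun i => e i % m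
  have hr0 : ∀ i, 0 ≤ r i := fun i => Int.emod_nonneg _ (by exact_mod_cast hm0)
  have hr1 : ∀ i, r i < m := fun i => Int.emod_lt_of_pos _ (by positivity)
  have hef : e = (m:ℤ) • f + r := by
    ext i
    simp only [Pi.add_apply, Pi.smul_apply, smul_eq_mul, f, r]
    rw [Int.mul_ediv_add_emod]
  have hxγ : x * γ = (m:ℤ) • b.equivFun.symm f + b.equivFun.symm r := by
    rw [← map_smul, ← map_add, ← hef, he, LinearEquiv.symm_apply_apply]
  refine ⟨β * b.equivFun.symm f, I.mul_mem_right _ hβI, ?_⟩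
  have hkey : (m:ℤ) • (x - β * b.equivFun.symm f) = β * b.equivFun.symm r := by
    have : (m:ℤ) • x = β * (x * γ) := by
      rw [zsmul_eq_mul, Int.cast_natCast, ← hγ]; ring
    rw [smul_sub, this, hxγ]
    simp only [zsmul_eq_mul]
    ring
  intro j
  have h1 : (m:ℤ) * b.repr (x - β * b.equivFun.symm f) j =
      ∑ k, ∑ i, ((a - a') k * r i) * b.repr (b k * b i) j := by
    have : b.repr ((m:ℤ) • (x - β * b.equivFun.symm f)) j = b.repr (β * b.equivFun.symm r) j := by
      rw [hkey]
    rw [map_smul, Finsupp.smul_apply, smul_eq_mul] at this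
    rw [this, hβ, b.equivFun_symm_apply, b.equivFun_symm_apply, Finset.sum_mul_sum]
    simp only [smul_mul_smul_comm, map_sum, map_smul, Finsupp.coe_finsetSum, Finset.sum_apply,
      Finsupp.smul_apply, smul_eq_mul]
  have h2 : |(m:ℤ) * b.repr (x - β * b.equivFun.symm f) j| ≤ m * (S * t) := by
    rw [h1]
    calc |∑ k, ∑ i, ((a - a') k * r i) * b.repr (b k * b i) j|
        ≤ ∑ k, ∑ i, |((a - a') k * r i) * b.repr (b k * b i) j| :=
          (Finset.abs_sum_le_sum_abs _ _).trans (Finset.sum_le_sum fun k _ =>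
            Finset.abs_sum_le_sum_abs _ _)
      _ ≤ ∑ k, ∑ i, (t * m) * ∑ j, |b.repr (b k * b i) j| := by
          apply Finset.sum_le_sum; intro k _
          apply Finset.sum_le_sum; intro i _
          rw [abs_mul, abs_mul]
          apply mul_le_mul
          · apply mul_le_mul (hβc k)
            · rw [abs_of_nonneg (hr0 i)]; exact (hr1 i).le
            · positivity
            · positivity
          · exact Finset.single_le_sum (f := fun j => |b.repr (b k * b i) j|)
              (fun _ _ => abs_nonneg _) (Finset.mem_univ j)
          · positivity
          · positivity
      _ = m * (S * t) := by
          rw [hS]; simp only [← Finset.mul_sum]; ring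
  rw [abs_mul, abs_of_nonneg (by positivity : (0:ℤ) ≤ m)] at h2
  have h3 := le_of_mul_le_mul_left h2 (by positivity)
  push_cast
  rwa [Int.toNat_of_nonneg hS0]

/-- uniform count of lattice points of an ideal in a box -/
lemma ideal_box_count (b : Module.Basis ι ℤ O) [Nonempty ι] (L : ℕ) : ∃ C : ℝ, 0 ≤ C ∧
    ∀ (Y : ℕ) (I : Ideal O) (s : O), I ≠ ⊥ → Ideal.absNorm I ≤ (L * Y) ^ Fintype.card ι →
    |(((Fintype.piFinset fun _ : ι => Finset.Ico (0:ℤ) Y).filter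
      (fun a => s + b.equivFun.symm a ∈ I)).card : ℝ) - (Y:ℝ) ^ Fintype.card ι / Ideal.absNorm I|
      ≤ C * (Y:ℝ) ^ (Fintype.card ι - 1) *
        (Ideal.absNorm I : ℝ) ^ ((1:ℝ) / Fintype.card ι - 1) := by
  obtain ⟨c, hc⟩ := small_reps b
  set n := Fintype.card ι with hn
  have hn1 : 1 ≤ n := Fintype.card_pos
  have hn0 : (0:ℝ) < n := by exact_mod_cast hn1
  refine ⟨2 * c * n * (1 + 2 * c * L)^(n-1), by positivity, ?_⟩
  intro Y I s hI hle
  set Nm := Ideal.absNorm I with hNm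
  have hNm0 : 0 < Nm := by
    rw [Nat.pos_iff_ne_zero, hNm, Ne, Ideal.absNorm_eq_zero_iff]; exact hI
  have hNr : (0:ℝ) < Nm := by exact_mod_cast hNm0
  set t := ⌊(Nm:ℝ)^((1:ℝ)/n)⌋₊ with ht
  have ht1 : (t:ℝ) ≤ (Nm:ℝ)^((1:ℝ)/n) := Nat.floor_le (by positivity)
  have ht2 : Nm < (t+1)^n := by
    have h1 : (Nm:ℝ)^((1:ℝ)/n) < t + 1 := Nat.lt_floor_add_one _
    have h2 : (Nm:ℝ) < ((t:ℝ)+1)^n := by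
      calc (Nm:ℝ) = ((Nm:ℝ)^((1:ℝ)/n))^n := by
            rw [← Real.rpow_natCast, ← Real.rpow_mul hNr.le, one_div_mul_cancel hn0.ne',
              Real.rpow_one]
        _ < _ := by gcongr
    exact_mod_cast h2
  have htY : (t:ℝ) ≤ L * Y := by
    refine ht1.trans ?_
    have : (Nm:ℝ) ≤ ((L:ℝ) * Y)^n := by exact_mod_cast hle
    calc (Nm:ℝ)^((1:ℝ)/n) ≤ (((L:ℝ) * Y)^n)^((1:ℝ)/n) := by gcongr
      _ = L * Y := by
        rw [← Real.rpow_natCast, ← Real.rpow_mul (by positivity), mul_one_div_cancel hn0.ne',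
              Real.rpow_one]
  obtain ⟨hu, hl⟩ := box_count b I hI (c * t) (hc I hI t ht2) s Y
  rw [← hNm, ← hn] at hu hl
  set A := ((Fintype.piFinset fun _ : ι => Finset.Ico (0:ℤ) Y).filter
      (fun a => s + b.equivFun.symm a ∈ I)).card with hA
  have hu' : (Nm:ℝ) * A ≤ ((Y:ℝ) + 2 * (c * t))^n := by exact_mod_cast hu
  have hl' : (((Y - 2 * (c * t) : ℕ) : ℝ))^n ≤ (Nm:ℝ) * A := by exact_mod_cast hl
  have hbd : (Y:ℝ) + 2 * (c * t) ≤ (1 + 2 * c * L) * Y := by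
    have : (c:ℝ) * t ≤ c * (L * Y) := by gcongr
    linarith
  have hb1 : ((Y:ℝ) + 2 * (c * t))^n - (Y:ℝ)^n ≤ 2 * (c * t) * n * ((1 + 2 * c * L) * Y)^(n-1) := by
    have := abs_pow_sub_pow_le ((Y:ℝ) + 2 * (c * t)) (Y:ℝ) n
    refine (le_abs_self _).trans (this.trans ?_)
    rw [add_sub_cancel_left, abs_of_nonneg (by positivity : (0:ℝ) ≤ 2 * (c*t))]
    gcongr
    rw [abs_of_nonneg (by positivity), abs_of_nonneg (by positivity)]
    apply max_le hbd
    have : (0:ℝ) ≤ c * t := by positivity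
    linarith
  have hb2 : (Y:ℝ)^n - (((Y - 2 * (c * t) : ℕ) : ℝ))^n ≤
      2 * (c * t) * n * ((1 + 2 * c * L) * Y)^(n-1) := by
    have h0 : ((Y - 2 * (c * t) : ℕ) : ℝ) ≤ Y := by exact_mod_cast Nat.sub_le _ _
    have h0' : (Y:ℝ) ≤ ((Y - 2 * (c * t) : ℕ) : ℝ) + 2 * (c * t) := by
      have : Y ≤ (Y - 2 * (c * t)) + 2 * (c * t) := by omega
      exact_mod_cast this
    have := abs_pow_sub_pow_le (Y:ℝ) (((Y - 2 * (c * t) : ℕ) : ℝ)) n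
    refine (le_abs_self _).trans (this.trans ?_)
    gcongr
    · rw [abs_le]; constructor
      · have : (0:ℝ) ≤ c * t := by positivity
        linarith
      · linarith
    · rw [abs_of_nonneg (by positivity), abs_of_nonneg (by positivity)]
      have h3 : (Y:ℝ) ≤ (1 + 2 * c * L) * Y := by
        have : (0:ℝ) ≤ c * L * Y := by positivity
        linarith
      exact max_le h3 (h0.trans h3)
  have hmul : |(Nm:ℝ) * A - (Y:ℝ)^n| ≤ 2 * (c * t) * n * ((1 + 2 * c * L) * Y)^(n-1) := by
    rw [abs_le]; constructor <;> linarith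
  have heq : (A:ℝ) - (Y:ℝ)^n / Nm = ((Nm:ℝ) * A - (Y:ℝ)^n) / Nm := by field_simp
  rw [heq, abs_div, abs_of_pos hNr, div_le_iff₀ hNr]
  refine hmul.trans ?_
  rw [Real.rpow_sub_one hNr.ne']
  have : 2 * (c:ℝ) * n * (1 + 2 * c * L)^(n-1) * (Y:ℝ)^(n-1) * ((Nm:ℝ)^((1:ℝ)/n) / Nm) * Nm
     = 2 * (c * (Nm:ℝ)^((1:ℝ)/n)) * n * ((1 + 2 * c * L) * Y)^(n-1) := by
    rw [mul_pow]; field_simp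
  rw [this]
  gcongr
end boxes

section ideals
variable {O : Type*} [CommRing O] [IsDedekindDomain O] [Module.Free ℤ O] [Module.Finite ℤ O]
  [CharZero O]

lemma two_le_absNorm {P : Ideal O} (hP : Prime P) : 2 ≤ Ideal.absNorm P := by
  have h0 : Ideal.absNorm P ≠ 0 := by rw [Ne, Ideal.absNorm_eq_zero_iff]; exact hP.ne_zero
  have h1 : Ideal.absNorm P ≠ 1 := by
    rw [Ne, Ideal.absNorm_eq_one_iff]
    intro h
    exact hP.not_isUnit (Ideal.isUnit_iff.mpr h)
  omega

lemma PP_finite (Z : ℕ) :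
    {q : Ideal O × ℕ | Prime q.1 ∧ 1 ≤ q.2 ∧ Ideal.absNorm q.1 ^ q.2 ≤ Z}.Finite := by
  apply ((Ideal.finite_setOfPred_absNorm_le (S := O) Z).prod (Set.finite_Iic Z)).subset
  rintro ⟨P, k⟩ ⟨hP, hk, hle⟩
  have h2 := two_le_absNorm hP
  constructor
  · exact (Nat.le_self_pow (by simp at hk ⊢; omega) _).trans hle
  · simp only [Set.mem_Iic]
    exact (Nat.lt_pow_self (by simp at h2 ⊢; omega)).le.trans hle

noncomputable def PP (O : Type*) [CommRing O] [IsDedekindDomain O] [Module.Free ℤ O]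
    [Module.Finite ℤ O] [CharZero O] (Z : ℕ) : Finset (Ideal O × ℕ) := (PP_finite (O := O) Z).toFinset

lemma mem_PP {Z : ℕ} {q : Ideal O × ℕ} :
    q ∈ PP O Z ↔ Prime q.1 ∧ 1 ≤ q.2 ∧ Ideal.absNorm q.1 ^ q.2 ≤ Z := by
  rw [PP, Set.Finite.mem_toFinset]; rfl

noncomputable def WW (O : Type*) [CommRing O] [IsDedekindDomain O] [Module.Free ℤ O]
    [Module.Finite ℤ O] [CharZero O] (m : ℕ) : ℝ :=
  ∑ q ∈ (PP O m).filter (fun q => Ideal.absNorm q.1 ^ q.2 = m), Real.log (Ideal.absNorm q.1)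

lemma WW_nonneg (m : ℕ) : 0 ≤ WW O m :=
  Finset.sum_nonneg fun _ _ => Real.log_natCast_nonneg _

lemma sum_PP (Z : ℕ) (f : ℕ → ℝ) :
    ∑ q ∈ PP O Z, Real.log (Ideal.absNorm q.1) * f (Ideal.absNorm q.1 ^ q.2) =
      ∑ m ∈ Finset.Ioc 0 Z, WW O m * f m := by
  rw [← Finset.sum_fiberwise_of_maps_to (t := Finset.Ioc 0 Z)
    (g := fun q : Ideal O × ℕ => Ideal.absNorm q.1 ^ q.2)]
  · apply Finset.sum_congr rfl
    intro m hm
    rw [WW, Finset.sum_mul]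
    have hset : (PP O Z).filter (fun q => Ideal.absNorm q.1 ^ q.2 = m) =
        (PP O m).filter (fun q => Ideal.absNorm q.1 ^ q.2 = m) := by
      ext q
      simp only [Finset.mem_filter, mem_PP]
      rw [Finset.mem_Ioc] at hm
      constructor
      · rintro ⟨⟨h1, h2, h3⟩, h4⟩; exact ⟨⟨h1, h2, h4.le⟩, h4⟩
      · rintro ⟨⟨h1, h2, h3⟩, h4⟩; exact ⟨⟨h1, h2, h3.trans hm.2⟩, h4⟩
    rw [hset]
    apply Finset.sum_congr rfl
    intro q hq
    rw [(Finset.mem_filter.mp hq).2]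
  · intro q hq
    rw [mem_PP] at hq
    rw [Finset.mem_Ioc]
    have := two_le_absNorm hq.1
    exact ⟨by positivity, hq.2.2⟩

lemma log_absNorm (J : Ideal O) (hJ : J ≠ ⊥) (Z : ℕ) (hZ : Ideal.absNorm J ≤ Z) :
    Real.log (Ideal.absNorm J) =
      ∑ q ∈ PP O Z, if J ≤ q.1 ^ q.2 then Real.log (Ideal.absNorm q.1) else 0 := by
  rw [← Finset.sum_filter]
  set fs := UniqueFactorizationMonoid.normalizedFactors J with hfs
  have hJ0 : Ideal.absNorm J ≠ 0 := by rwa [Ne, Ideal.absNorm_eq_zero_iff]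
  have hpow : ∀ P : Ideal O, Prime P → ∀ k, P ^ k ∣ J ↔ k ≤ fs.count P := by
    intro P hP k
    rw [pow_dvd_iff_le_emultiplicity,
      UniqueFactorizationMonoid.emultiplicity_eq_count_normalizedFactors hP.irreducible hJ,
      normalize_eq]
    exact Nat.cast_le
  rw [Finset.sum_finset_product _ fs.toFinset (fun P => Finset.Icc 1 (fs.count P))]
  · simp only [Finset.sum_const, Nat.card_Icc, Nat.add_sub_cancel, nsmul_eq_mul]
    have h1 : J = fs.prod := by
      exact (Ideal.prod_normalizedFactors_eq_self hJ).symm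
    conv_lhs => rw [h1]
    rw [Finset.prod_multiset_count, map_prod]
    push_cast
    rw [Real.log_prod]
    · apply Finset.sum_congr rfl
      intro P _
      rw [map_pow]; push_cast; rw [Real.log_pow]
    · intro P hP
      rw [Multiset.mem_toFinset] at hP
      have := two_le_absNorm (UniqueFactorizationMonoid.prime_of_normalized_factor _ hP)
      rw [map_pow]
      positivity
  · rintro ⟨P, k⟩
    simp only [Finset.mem_filter, mem_PP, Multiset.mem_toFinset, Finset.mem_Icc]
    rw [← Ideal.dvd_iff_le]
    constructor
    · rintro ⟨⟨h1, h2, h3⟩, h4⟩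
      have h5 := (hpow P h1 k).mp h4
      refine ⟨?_, h2, h5⟩
      rw [← Multiset.count_pos]; omega
    · rintro ⟨h1, h2, h3⟩
      have hP := UniqueFactorizationMonoid.prime_of_normalized_factor _ h1
      have h4 := (hpow P hP k).mpr h3
      refine ⟨⟨hP, h2, ?_⟩, h4⟩
      rw [← map_pow]
      exact (Nat.le_of_dvd (Nat.pos_of_ne_zero hJ0) (map_dvd Ideal.absNorm h4)).trans hZ

lemma prime_data {P : Ideal O} (hP : Prime P) :
    ∃ p f : ℕ, p.Prime ∧ 0 < f ∧ P ∣ Ideal.span {(p : O)} ∧ Ideal.absNorm P = p ^ f := by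
  have hprime := Ideal.isPrime_of_prime hP
  have hmax : P.IsMaximal := hprime.isMaximal hP.ne_zero
  obtain ⟨p, f, hf, hp, hpp, h⟩ := Ideal.exists_prime_and_absNorm_eq_pow P
  refine ⟨p, f, hpp, hf, ?_, h⟩
  rw [Ideal.dvd_iff_le, Ideal.span_singleton_le_iff_mem]
  exact hp

lemma WW_le (m : ℕ) : WW O m ≤
    ((Module.finrank ℤ O : ℝ) * Module.finrank ℤ O) * ArithmeticFunction.vonMangoldt m := by
  set n := Module.finrank ℤ O with hn
  set T := (PP O m).filter (fun q => Ideal.absNorm q.1 ^ q.2 = m) with hT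
  rcases T.eq_empty_or_nonempty with h | ⟨q0, hq0⟩
  · rw [WW, ← hT, h, Finset.sum_empty]
    have := ArithmeticFunction.vonMangoldt_nonneg (n := m)
    positivity
  have hmem : ∀ q, q ∈ T ↔ Prime q.1 ∧ 1 ≤ q.2 ∧ Ideal.absNorm q.1 ^ q.2 = m := by
    intro q
    rw [hT, Finset.mem_filter, mem_PP]
    constructor
    · rintro ⟨⟨h1, h2, h3⟩, h4⟩; exact ⟨h1, h2, h4⟩
    · rintro ⟨h1, h2, h4⟩; exact ⟨⟨h1, h2, h4.le⟩, h4⟩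
  obtain ⟨h1, h2, h3⟩ := (hmem q0).mp hq0
  obtain ⟨p, f, hp, hf, hd, hN⟩ := prime_data h1
  have hm : m = p ^ (f * q0.2) := by rw [← h3, hN, pow_mul]
  have hL : ArithmeticFunction.vonMangoldt m = Real.log p := by
    rw [hm, ArithmeticFunction.vonMangoldt_apply_pow (by positivity),
      ArithmeticFunction.vonMangoldt_apply_prime hp]
  have hspan : Ideal.absNorm (Ideal.span {(p:O)}) = p ^ n := Ideal.absNorm_span_natCast p
  have key : ∀ q ∈ T, q.1 ∣ Ideal.span {(p:O)} ∧ p ≤ Ideal.absNorm q.1 := by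
    intro q hq
    obtain ⟨g1, g2, g3⟩ := (hmem q).mp hq
    obtain ⟨p', f', hp', hf', hd', hN'⟩ := prime_data g1
    have : p' = p := by
      have hm' : m = p' ^ (f' * q.2) := by rw [← g3, hN', pow_mul]
      have : p' ∣ p ^ (f * q0.2) := by
        rw [← hm, hm']; exact dvd_pow_self _ (by positivity)
      exact (Nat.prime_dvd_prime_iff_eq hp' hp).mp (hp'.dvd_of_dvd_pow this)
    subst this
    refine ⟨hd', ?_⟩
    rw [hN']; exact Nat.le_self_pow (by omega) _
  have hlog : ∀ q ∈ T, Real.log (Ideal.absNorm q.1) ≤ n * Real.log p := by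
    intro q hq
    have g1 := map_dvd Ideal.absNorm (key q hq).1
    rw [hspan] at g1
    have g2 : Ideal.absNorm q.1 ≤ p ^ n := Nat.le_of_dvd (pow_pos hp.pos _) g1
    rw [← Real.log_pow]
    apply Real.log_le_log
    · have := two_le_absNorm ((hmem q).mp hq).1; positivity
    · exact_mod_cast g2
  have hinj : Set.InjOn (fun q : Ideal O × ℕ => q.1) T := by
    rintro ⟨P, k⟩ hq ⟨P', k'⟩ hq' heq
    simp only at heq
    subst heq
    have g1 := (hmem _).mp hq
    have g2 := (hmem _).mp hq'
    have := two_le_absNorm g1.1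
    have : k = k' := Nat.pow_right_injective this (g1.2.2.trans g2.2.2.symm)
    rw [this]
  have hcard : T.card ≤ n := by
    have hdvd : ∏ P ∈ T.image (fun q : Ideal O × ℕ => q.1), P ∣ Ideal.span {(p:O)} := by
      apply Finset.prod_primes_dvd
      · intro P hP
        obtain ⟨q, hq, rfl⟩ := Finset.mem_image.mp hP
        exact ((hmem q).mp hq).1
      · intro P hP
        obtain ⟨q, hq, rfl⟩ := Finset.mem_image.mp hP
        exact (key q hq).1
    have g1 := map_dvd Ideal.absNorm hdvd
    rw [hspan, map_prod, Finset.prod_image hinj] at g1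
    have g2 := Nat.le_of_dvd (pow_pos hp.pos _) g1
    have g3 : p ^ T.card ≤ ∏ q ∈ T, Ideal.absNorm q.1 :=
      Finset.pow_card_le_prod _ _ _ (fun q hq => (key q hq).2)
    exact (Nat.pow_le_pow_iff_right hp.one_lt).mp (g3.trans g2)
  rw [WW, ← hT, hL]
  have hlp : 0 ≤ Real.log p := Real.log_natCast_nonneg _
  calc ∑ q ∈ T, Real.log (Ideal.absNorm q.1) ≤ T.card • (n * Real.log p) :=
        Finset.sum_le_card_nsmul _ _ _ hlog
    _ = T.card * (n * Real.log p) := by rw [nsmul_eq_mul]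
    _ ≤ n * (n * Real.log p) := by gcongr
    _ = _ := by ring

lemma WW_prime (p : ℕ) (hp : p.Prime) :
    WW O p = Set.ncard {P : Ideal O | Prime P ∧ Ideal.absNorm P = p} * Real.log p := by
  set T := (PP O p).filter (fun q => Ideal.absNorm q.1 ^ q.2 = p) with hT
  have hmem : ∀ q, q ∈ T ↔ (Prime q.1 ∧ Ideal.absNorm q.1 = p) ∧ q.2 = 1 := by
    intro q
    rw [hT, Finset.mem_filter, mem_PP]
    constructor
    · rintro ⟨⟨h1, h2, h3⟩, h4⟩
      have h5 : q.2 = 1 := by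
        have := hp.prime.irreducible
        rw [← h4] at this
        by_contra hne
        exact not_irreducible_pow hne this
      refine ⟨⟨h1, ?_⟩, h5⟩
      rw [h5, pow_one] at h4; exact h4
    · rintro ⟨⟨h1, h2⟩, h4⟩
      rw [h4, pow_one]
      exact ⟨⟨h1, le_rfl, h2.le⟩, h2⟩
  have hset : {P : Ideal O | Prime P ∧ Ideal.absNorm P = p} =
      ((T.image (fun q : Ideal O × ℕ => q.1) : Finset (Ideal O)) : Set (Ideal O)) := by
    ext P
    simp only [Set.mem_ofPred_eq, Finset.coe_image, Set.mem_image, Finset.mem_coe, hmem]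
    constructor
    · intro h; exact ⟨(P, 1), ⟨h, rfl⟩, rfl⟩
    · rintro ⟨q, ⟨h, _⟩, rfl⟩; exact h
  rw [hset, Set.ncard_coe_finset, Finset.card_image_of_injOn, WW, ← hT]
  · rw [Finset.sum_congr rfl (g := fun _ => Real.log p)]
    · simp
    · intro q hq; rw [((hmem q).mp hq).1.2]
  · rintro ⟨P, k⟩ hq ⟨P', k'⟩ hq' heq
    have g1 := (hmem _).mp hq
    have g2 := (hmem _).mp hq'
    simp only at heq g1 g2
    rw [heq, g1.2, g2.2]
end ideals

section main
open NumberField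
variable {K : Type*} [Field K] [NumberField K] {ι : Type*} [Fintype ι]

lemma norm_box (b : Module.Basis ι ℤ (𝓞 K)) : ∃ L : ℕ, 1 ≤ L ∧ ∀ Y : ℕ, 1 ≤ Y → ∀ a : ι → ℤ,
    (∀ i, 0 ≤ a i ∧ a i < Y) →
    Y ^ Fintype.card ι ≤ Ideal.absNorm (Ideal.span {((L * Y : ℕ) : 𝓞 K) + b.equivFun.symm a}) ∧
    Ideal.absNorm (Ideal.span {((L * Y : ℕ) : 𝓞 K) + b.equivFun.symm a})
      ≤ (2 * L * Y) ^ Fintype.card ι := by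
  set S : ℝ := ∑ σ : K →ₐ[ℚ] ℂ, ∑ i, ‖σ (b i : K)‖ with hS
  have hS0 : 0 ≤ S := by positivity
  set L : ℕ := ⌈S⌉₊ + 1 with hL
  have hLS : S + 1 ≤ L := by rw [hL]; push_cast; linarith [Nat.le_ceil S]
  refine ⟨L, by omega, ?_⟩
  intro Y hY a ha
  set α : 𝓞 K := ((L * Y : ℕ) : 𝓞 K) + b.equivFun.symm a with hα
  have hYr : (1:ℝ) ≤ Y := by exact_mod_cast hY
  have hσ : ∀ σ : K →ₐ[ℚ] ℂ, (Y:ℝ) ≤ ‖σ (α : K)‖ ∧ ‖σ (α : K)‖ ≤ 2 * L * Y := by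
    intro σ
    have e : σ (α : K) = ((L * Y : ℝ) : ℂ) + ∑ i, (a i : ℂ) * σ (b i : K) := by
      rw [hα, Module.Basis.equivFun_symm_apply]
      simp [map_sum]
    have h1 : ‖∑ i, (a i : ℂ) * σ (b i : K)‖ ≤ Y * S := by
      calc _ ≤ ∑ i, ‖(a i : ℂ) * σ (b i : K)‖ := norm_sum_le _ _
        _ ≤ ∑ i, Y * ‖σ (b i : K)‖ := by
            apply Finset.sum_le_sum; intro i _
            rw [norm_mul]
            gcongr
            rw [Complex.norm_intCast, abs_of_nonneg (by exact_mod_cast (ha i).1)]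
            exact_mod_cast (ha i).2.le
        _ = Y * ∑ i, ‖σ (b i : K)‖ := by rw [Finset.mul_sum]
        _ ≤ Y * S := by
            gcongr
            exact Finset.single_le_sum (f := fun σ : K →ₐ[ℚ] ℂ => ∑ i, ‖σ (b i : K)‖)
              (fun _ _ => by positivity) (Finset.mem_univ σ)
    have h2 : ‖((L * Y : ℝ) : ℂ)‖ = L * Y := by
      rw [Complex.norm_real, Real.norm_of_nonneg (by positivity)]
    have h3 := norm_add_le ((L * Y : ℝ) : ℂ) (∑ i, (a i : ℂ) * σ (b i : K))
    have h4 := norm_sub_le (((L * Y : ℝ) : ℂ) + (∑ i, (a i : ℂ) * σ (b i : K))) (∑ i, (a i : ℂ) * σ (b i : K))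
    rw [add_sub_cancel_right, h2] at h4
    rw [h2] at h3
    rw [e]
    constructor <;> nlinarith
  have hcard : Fintype.card (K →ₐ[ℚ] ℂ) = Fintype.card ι := by
    rw [AlgHom.card, ← RingOfIntegers.rank, Module.finrank_eq_card_basis b]
  have hnorm : (Ideal.absNorm (Ideal.span {α}) : ℝ) = ∏ σ : K →ₐ[ℚ] ℂ, ‖σ (α : K)‖ := by
    rw [Ideal.absNorm_span_singleton, Nat.cast_natAbs, ← norm_prod,
      ← Algebra.norm_eq_prod_embeddings, ← Algebra.coe_norm_int]
    simp
  constructor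
  · have : (Y:ℝ) ^ Fintype.card ι ≤ Ideal.absNorm (Ideal.span {α}) := by
      rw [hnorm, ← hcard, ← Finset.card_univ, ← Finset.prod_const]
      exact Finset.prod_le_prod (fun _ _ => by positivity) (fun σ _ => (hσ σ).1)
    exact_mod_cast this
  · have : (Ideal.absNorm (Ideal.span {α}) : ℝ) ≤ (2 * L * Y : ℝ) ^ Fintype.card ι := by
      rw [hnorm, ← hcard, ← Finset.card_univ, ← Finset.prod_const]
      exact Finset.prod_le_prod (fun _ _ => by positivity) (fun σ _ => (hσ σ).2)
    exact_mod_cast this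

lemma field_mertens (K : Type*) [Field K] [NumberField K] : ∃ M : ℝ, ∀ x : ℝ, 2 ≤ x →
    |∑ p ∈ (Icc 1 ⌊x⌋₊).filter Nat.Prime, WW (𝓞 K) p / p - Real.log x| ≤ M := by
  set b := RingOfIntegers.basis K
  set ι := Module.Free.ChooseBasisIndex ℤ (𝓞 K)
  set n := Fintype.card ι with hn
  have hne : Nonempty ι := b.index_nonempty
  have hn1 : 1 ≤ n := Fintype.card_pos
  obtain ⟨L, hL1, hL⟩ := norm_box b
  obtain ⟨C, hC0, hC⟩ := ideal_box_count b (2 * L)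
  set C' : ℝ := max C (max ((Module.finrank ℤ (𝓞 K) : ℝ) * Module.finrank ℤ (𝓞 K))
    (n * Real.log (2 * L : ℕ)))
  have hCC : C ≤ C' := le_max_left _ _
  have hC2 : ((Module.finrank ℤ (𝓞 K) : ℝ) * Module.finrank ℤ (𝓞 K)) ≤ C' :=
    (le_max_left _ _).trans (le_max_right _ _)
  have hC3 : (n * Real.log (2 * L : ℕ)) ≤ C' :=
    (le_max_right _ _).trans (le_max_right _ _)
  refine analytic_core (WW (𝓞 K)) WW_nonneg C' (hC0.trans hCC) ?_ n hn1 (2 * L) (by omega) ?_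
  · intro m
    exact (WW_le m).trans (mul_le_mul_of_nonneg_right hC2 ArithmeticFunction.vonMangoldt_nonneg)
  intro Y hY
  set Z := (2 * L * Y) ^ n with hZ
  set box := Fintype.piFinset fun _ : ι => Finset.Ico (0:ℤ) Y with hbox
  have hYr : (1:ℝ) ≤ Y := by exact_mod_cast hY
  have hcard : (box.card : ℝ) = (Y:ℝ)^n := by
    rw [hbox, Fintype.card_piFinset]; simp [hn]
  set α : (ι → ℤ) → 𝓞 K := fun a => ((L * Y : ℕ) : 𝓞 K) + b.equivFun.symm a with hα
  have hLa : ∀ a ∈ box, Y ^ n ≤ Ideal.absNorm (Ideal.span {α a}) ∧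
      Ideal.absNorm (Ideal.span {α a}) ≤ Z := by
    intro a ha
    refine hL Y hY a ?_
    intro i
    have := Fintype.mem_piFinset.mp ha i
    simpa using this
  -- total sum
  have htot : ∑ a ∈ box, Real.log (Ideal.absNorm (Ideal.span {α a})) =
      ∑ q ∈ PP (𝓞 K) Z, Real.log (Ideal.absNorm q.1) *
        ((box.filter (fun a => α a ∈ q.1 ^ q.2)).card : ℝ) := by
    have h1 : ∀ a ∈ box, Real.log (Ideal.absNorm (Ideal.span {α a})) =
        ∑ q ∈ PP (𝓞 K) Z, if α a ∈ q.1 ^ q.2 then Real.log (Ideal.absNorm q.1) else 0 := by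
      intro a ha
      have hne0 : Ideal.span {α a} ≠ ⊥ := by
        intro h
        have := (hLa a ha).1
        rw [h, Ideal.absNorm_bot] at this
        have := Nat.pow_pos (n := n) hY
        omega
      rw [log_absNorm _ hne0 Z (hLa a ha).2]
      simp only [Ideal.span_singleton_le_iff_mem]
    rw [Finset.sum_congr rfl h1, Finset.sum_comm]
    apply Finset.sum_congr rfl
    intro q _
    rw [← Finset.sum_filter, Finset.sum_const, nsmul_eq_mul, mul_comm]
  have hlow : |∑ a ∈ box, Real.log (Ideal.absNorm (Ideal.span {α a})) - (Y:ℝ)^n * (n * Real.log Y)|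
      ≤ C' * (Y:ℝ)^n := by
    have : (Y:ℝ)^n * (n * Real.log Y) = ∑ a ∈ box, (n * Real.log Y) := by
      rw [Finset.sum_const, nsmul_eq_mul, hcard]
    rw [this, ← Finset.sum_sub_distrib]
    refine (Finset.abs_sum_le_sum_abs _ _).trans ?_
    rw [← hcard, mul_comm C', ← nsmul_eq_mul (#box)]
    apply Finset.sum_le_card_nsmul
    intro a ha
    obtain ⟨h1, h2⟩ := hLa a ha
    have hpos : (0:ℝ) < (Y:ℝ)^n := by positivity
    have h1' : (Y:ℝ)^n ≤ Ideal.absNorm (Ideal.span {α a}) := by exact_mod_cast h1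
    have h2' : (Ideal.absNorm (Ideal.span {α a}) : ℝ) ≤ (((2 * L : ℕ):ℝ) * Y)^n := by
      exact_mod_cast h2
    have l1 := Real.log_le_log hpos h1'
    have l2 := Real.log_le_log (hpos.trans_le h1') h2'
    rw [Real.log_pow] at l1 l2
    rw [Real.log_mul (by positivity) (by positivity)] at l2
    rw [abs_of_nonneg (by linarith)]
    linarith
  have hdiff : |∑ m ∈ Ioc 0 Z, WW (𝓞 K) m * ((Y:ℝ)^n / m) -
      ∑ a ∈ box, Real.log (Ideal.absNorm (Ideal.span {α a}))| ≤
      C' * (Y:ℝ)^(n-1) * ∑ m ∈ Ioc 0 Z, WW (𝓞 K) m * (m:ℝ)^((1:ℝ)/n - 1) := by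
    rw [htot, ← sum_PP Z (fun m => (Y:ℝ)^n / m), ← sum_PP Z (fun m => (m:ℝ)^((1:ℝ)/n - 1)),
      ← Finset.sum_sub_distrib, Finset.mul_sum]
    refine (Finset.abs_sum_le_sum_abs _ _).trans (Finset.sum_le_sum ?_)
    intro q hq
    obtain ⟨hp, hk, hle⟩ := mem_PP.mp hq
    have := hC Y (q.1 ^ q.2) ((L * Y : ℕ) : 𝓞 K) (pow_ne_zero _ hp.ne_zero)
      (by rw [map_pow]; exact hle)
    rw [map_pow, abs_sub_comm] at this
    have hlog : 0 ≤ Real.log (Ideal.absNorm q.1) := Real.log_natCast_nonneg _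
    rw [← mul_sub, abs_mul, abs_of_nonneg hlog]
    calc _ ≤ Real.log (Ideal.absNorm q.1) * (C * (Y:ℝ) ^ (n - 1) *
        ((Ideal.absNorm q.1 ^ q.2 : ℕ) : ℝ) ^ ((1:ℝ) / n - 1)) := by
          gcongr
      _ ≤ Real.log (Ideal.absNorm q.1) * (C' * (Y:ℝ) ^ (n - 1) *
        ((Ideal.absNorm q.1 ^ q.2 : ℕ) : ℝ) ^ ((1:ℝ) / n - 1)) := by
          gcongr
      _ = _ := by ring
  calc _ = |(∑ m ∈ Ioc 0 Z, WW (𝓞 K) m * ((Y:ℝ)^n / m) -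
      ∑ a ∈ box, Real.log (Ideal.absNorm (Ideal.span {α a}))) +
      (∑ a ∈ box, Real.log (Ideal.absNorm (Ideal.span {α a})) - (Y:ℝ)^n * (n * Real.log Y))| := by
        congr 1; ring
    _ ≤ _ := (abs_add_le _ _)
    _ ≤ _ := by linarith
end main

section roots
open NumberField

lemma exponent_ne_zero {K : Type*} [Field K] [NumberField K] (η : 𝓞 K)
    (h : Algebra.adjoin ℚ {(η : K)} = ⊤) : RingOfIntegers.exponent η ≠ 0 := by
  have key : ∀ y : K, ∃ m : ℕ, 0 < m ∧ ∃ z ∈ Algebra.adjoin ℤ {η}, (m : K) * y = (z : K) := by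
    intro y
    have hy : y ∈ Algebra.adjoin ℚ {(η : K)} := by rw [h]; trivial
    induction hy using Algebra.adjoin_induction with
    | mem x hx =>
      rw [Set.mem_singleton_iff] at hx
      exact ⟨1, one_pos, η, Algebra.subset_adjoin rfl, by simp [hx]⟩
    | algebraMap r =>
      refine ⟨r.den, r.den_pos, algebraMap ℤ _ r.num, Subalgebra.algebraMap_mem _ _, ?_⟩
      have := Rat.den_mul_eq_num r
      have h2 : ((r.den * r : ℚ) : K) = ((r.num : ℚ) : K) := by rw [this]
      push_cast at h2
      simpa using h2
    | add x y _ _ hx hy =>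
      obtain ⟨m, hm, z, hz, e⟩ := hx
      obtain ⟨m', hm', z', hz', e'⟩ := hy
      refine ⟨m * m', Nat.mul_pos hm hm', (m' : 𝓞 K) * z + (m : 𝓞 K) * z', ?_, ?_⟩
      · exact add_mem (mul_mem (natCast_mem _ _) hz) (mul_mem (natCast_mem _ _) hz')
      · have h1 : (((m' : 𝓞 K) * z + (m : 𝓞 K) * z' : 𝓞 K) : K) = m' * (z : K) + m * (z' : K) := by
          simp
        rw [h1, ← e, ← e']; push_cast; ring
    | mul x y _ _ hx hy =>
      obtain ⟨m, hm, z, hz, e⟩ := hx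
      obtain ⟨m', hm', z', hz', e'⟩ := hy
      refine ⟨m * m', Nat.mul_pos hm hm', z * z', mul_mem hz hz', ?_⟩
      have h1 : ((z * z' : 𝓞 K) : K) = (z : K) * (z' : K) := by simp
      rw [h1, ← e, ← e']; push_cast; ring
  set b := RingOfIntegers.basis K
  choose m hm z hz e using fun i => key (b i : K)
  have e' : ∀ i, (m i : 𝓞 K) * b i = z i := by
    intro i
    apply RingOfIntegers.coe_injective
    simpa using e i
  rw [RingOfIntegers.exponent_eq_sInf]
  refine (Nat.sInf_mem (s := {d : ℕ | 0 < d ∧ (d : 𝓞 K) ∈ conductor ℤ η}) ⟨∏ i, m i, Finset.prod_pos fun i _ => hm i, ?_⟩).1.ne'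
  rw [mem_conductor_iff]
  intro y
  rw [← b.sum_repr y, Finset.mul_sum]
  refine sum_mem fun i _ => ?_
  rw [← Finset.mul_prod_erase _ _ (Finset.mem_univ i)]
  have : ((m i * ∏ x ∈ univ.erase i, m x : ℕ) : 𝓞 K) * (b.repr y i • b i) =
    ((∏ x ∈ univ.erase i, m x : ℕ) : 𝓞 K) * (b.repr y i • z i) := by
    rw [← e' i]; push_cast; simp only [zsmul_eq_mul]; ring
  rw [this]
  exact mul_mem (natCast_mem _ _) (Subalgebra.zsmul_mem _ (hz i) _)

lemma card_primes_eq_roots {K : Type*} [Field K] [NumberField K] (η : 𝓞 K) (p : ℕ) [Fact p.Prime]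
    (hp : ¬ p ∣ RingOfIntegers.exponent η) :
    Set.ncard {P : Ideal (𝓞 K) | Prime P ∧ Ideal.absNorm P = p} =
      Set.ncard {r : ZMod p | ((minpoly ℤ η).map (Int.castRingHom (ZMod p))).IsRoot r} := by
  set G := (minpoly ℤ η).map (Int.castRingHom (ZMod p)) with hG
  have hG0 : G ≠ 0 := Polynomial.map_monic_ne_zero (minpoly.monic η.isIntegral)
  have hpp : p.Prime := Fact.out
  set E := NumberField.Ideal.primesOverSpanEquivMonicFactorsMod hp
  have hmem : ∀ r : ZMod p, G.IsRoot r →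
      Polynomial.X - Polynomial.C r ∈ RingOfIntegers.monicFactorsMod η p := by
    intro r hr
    rw [Multiset.mem_toFinset, UniqueFactorizationMonoid.mem_normalizedFactors_iff' hG0]
    exact ⟨Polynomial.irreducible_X_sub_C r, (Polynomial.monic_X_sub_C r).normalize_eq_self,
      Polynomial.dvd_iff_isRoot.mpr hr⟩
  have hnorm : ∀ Q : RingOfIntegers.monicFactorsMod η p,
      Ideal.absNorm ((E.symm Q : _) : Ideal (𝓞 K)) = p ^ (Q : Polynomial (ZMod p)).natDegree := by
    intro Q
    have h1 := (E.symm Q).2.1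
    have h2 := (E.symm Q).2.2
    have h3 := NumberField.Ideal.inertiaDeg_primesOverSpanEquivMonicFactorsMod_symm_apply' hp Q.2
    have h4 := Ideal.absNorm_pow_inertiaDeg (Ideal.span {(p:ℤ)}) ((E.symm Q : _) : Ideal (𝓞 K))
    rw [← h4]
    simp only [E]
    rw [h3]
    simp
  symm
  refine Set.ncard_congr (fun r hr => ((E.symm ⟨_, hmem r hr⟩ : _) : Ideal (𝓞 K))) ?_ ?_ ?_
  · intro r hr
    have hN := hnorm ⟨_, hmem r hr⟩
    simp only [Polynomial.natDegree_X_sub_C, pow_one] at hN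
    refine ⟨?_, hN⟩
    refine Ideal.prime_of_isPrime ?_ (E.symm _).2.1
    intro h0
    rw [h0] at hN
    simp at hN
    exact hpp.ne_zero hN.symm
  · intro r s hr hs h
    have := E.symm.injective (Subtype.ext h)
    have := Subtype.ext_iff.mp this
    simpa using this
  · rintro P ⟨hP, hPN⟩
    have hPp := Ideal.isPrime_of_prime hP
    have hover : P ∈ Ideal.primesOver (Ideal.span {(p:ℤ)}) (𝓞 K) := by
      refine ⟨hPp, ⟨?_⟩⟩
      have hmax := Int.ideal_span_isMaximal_of_prime p
      refine hmax.eq_of_le (Ideal.IsPrime.under ℤ P).ne_top ?_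
      rw [Ideal.span_singleton_le_iff_mem, Ideal.mem_comap]
      have := Ideal.absNorm_mem P
      rw [hPN] at this
      simpa using this
    have hd : ((E ⟨P, hover⟩ : _) : Polynomial (ZMod p)).natDegree = 1 := by
      have := hnorm (E ⟨P, hover⟩)
      rw [Equiv.symm_apply_apply] at this
      simp only [hPN] at this
      have h2 : p ^ 1 = p ^ ((E ⟨P, hover⟩ : _) : Polynomial (ZMod p)).natDegree := by rw [pow_one]; exact this
      exact (Nat.pow_right_injective hpp.two_le h2).symm
    have hQ := (E ⟨P, hover⟩).2
    rw [Multiset.mem_toFinset, UniqueFactorizationMonoid.mem_normalizedFactors_iff' hG0] at hQ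
    obtain ⟨h1, h2, h3⟩ := hQ
    have hmon : ((E ⟨P, hover⟩ : _) : Polynomial (ZMod p)).Monic := by
      rw [← h2]; exact Polynomial.monic_normalize h1.ne_zero
    obtain hX := hmon.eq_X_add_C hd
    set c := ((E ⟨P, hover⟩ : _) : Polynomial (ZMod p)).coeff 0
    have hX' : ((E ⟨P, hover⟩ : _) : Polynomial (ZMod p)) = Polynomial.X - Polynomial.C (-c) := by
      rw [hX]; simp
    refine ⟨-c, ?_, ?_⟩
    · rw [hX'] at h3; exact Polynomial.dvd_iff_isRoot.mp h3
    · have : (⟨_, hmem (-c) (by rw [hX'] at h3; exact Polynomial.dvd_iff_isRoot.mp h3)⟩ : RingOfIntegers.monicFactorsMod η p) = E ⟨P, hover⟩ := Subtype.ext hX'.symm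
      rw [this, Equiv.symm_apply_apply]
end roots

section roots2
open NumberField

lemma rootCount_eq_ncard (F : Polynomial ℤ) (hdeg : 1 ≤ F.natDegree) (p : ℕ) [Fact p.Prime]
    (hp : ((F.leadingCoeff : ℤ) : ZMod p) ≠ 0) :
    Set.ncard {r : ZMod p | (F.integralNormalization.map (Int.castRingHom (ZMod p))).IsRoot r} =
      rootCount F p := by
  have hpp : p.Prime := Fact.out
  rw [rootCount, ← Set.ncard_coe_finset]
  symm
  have hev : ∀ r : ℕ, (F.integralNormalization.map (Int.castRingHom (ZMod p))).IsRoot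
      (((F.leadingCoeff : ℤ) : ZMod p) * (r : ZMod p)) ↔ (p:ℤ) ∣ F.eval (r:ℤ) := by
    intro r
    have h1 := Polynomial.integralNormalization_eval₂_leadingCoeff_mul hdeg
      (Int.castRingHom (ZMod p)) (r : ZMod p)
    have h2 : Polynomial.eval₂ (Int.castRingHom (ZMod p)) (r : ZMod p) F =
        ((F.eval (r:ℤ) : ℤ) : ZMod p) := by
      have := Polynomial.eval₂_at_apply (p := F) (Int.castRingHom (ZMod p)) (r:ℤ)
      simpa using this
    rw [Polynomial.IsRoot, Polynomial.eval_map, ← ZMod.intCast_zmod_eq_zero_iff_dvd, ← h2]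
    rw [eq_intCast] at h1
    rw [h1]
    simp [hp]
  refine Set.ncard_congr (fun r _ => ((F.leadingCoeff : ℤ) : ZMod p) * (r : ZMod p)) ?_ ?_ ?_
  · intro r hr
    simp only [Finset.coe_filter, Finset.mem_range] at hr
    exact (hev r).mpr hr.2
  · intro r s hr hs h
    simp only [Finset.coe_filter, Finset.mem_range] at hr hs
    have := mul_left_cancel₀ hp h
    rw [ZMod.natCast_eq_natCast_iff'] at this
    rwa [Nat.mod_eq_of_lt hr.1, Nat.mod_eq_of_lt hs.1] at this
  · intro y hy
    set z := (((F.leadingCoeff : ℤ) : ZMod p))⁻¹ * y with hz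
    have e : ((F.leadingCoeff : ℤ) : ZMod p) * ((z.val : ℕ) : ZMod p) = y := by
      rw [ZMod.natCast_zmod_val, hz, mul_inv_cancel_left₀ hp]
    refine ⟨z.val, ?_, e⟩
    simp only [Finset.coe_filter, Finset.mem_range]
    refine ⟨ZMod.val_lt z, ?_⟩
    rw [← hev, e]
    exact hy

lemma exists_field (F : Polynomial ℤ) (hirr : Irreducible (F.map (algebraMap ℤ ℚ))) :
    ∃ (K : Type) (_ : Field K) (_ : NumberField K) (θ : K),
      Polynomial.eval₂ (algebraMap ℤ K) θ F = 0 ∧ Algebra.adjoin ℚ {θ} = ⊤ ∧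
      Module.finrank ℚ K = F.natDegree := by
  have : Fact (Irreducible (F.map (algebraMap ℤ ℚ))) := ⟨hirr⟩
  set f := F.map (algebraMap ℤ ℚ) with hf
  have hfd : f.natDegree = F.natDegree :=
    Polynomial.natDegree_map_eq_of_injective (algebraMap ℤ ℚ).injective_int F
  let K := AdjoinRoot f
  have : FiniteDimensional ℚ K := (AdjoinRoot.powerBasis hirr.ne_zero).finite
  have : CharZero K := algebraRat.charZero K
  refine ⟨K, inferInstance, ⟨⟩, AdjoinRoot.root f, ?_, AdjoinRoot.adjoinRoot_eq_top, ?_⟩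
  · have h := AdjoinRoot.eval₂_root f
    rw [hf, Polynomial.eval₂_map] at h
    refine Eq.trans ?_ h
    exact congrArg (fun g : ℤ →+* K => Polynomial.eval₂ g (AdjoinRoot.root f) F)
      (RingHom.ext_int _ _)
  · rw [(AdjoinRoot.powerBasis hirr.ne_zero).finrank, AdjoinRoot.powerBasis_dim, hfd]

lemma poly_mertens (F : Polynomial ℤ)
    (hdeg : 1 ≤ F.natDegree) (hirr : Irreducible (F.map (algebraMap ℤ ℚ))) :
    ∃ M : ℝ, ∀ x : ℝ, 2 ≤ x →
      |(∑ p ∈ (Finset.Icc 1 ⌊x⌋₊).filter Nat.Prime, ((rootCount F p : ℝ) / p) * Real.log p)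
        - Real.log x| ≤ M := by
  obtain ⟨K, _, _, θ, hθ, htop, h3⟩ := exists_field F hirr
  have hF0 : F ≠ 0 := by rintro rfl; simp at hdeg
  have hlc : F.leadingCoeff ≠ 0 := Polynomial.leadingCoeff_ne_zero.mpr hF0
  have hroot : Polynomial.aeval ((F.leadingCoeff : K) * θ) F.integralNormalization = 0 := by
    rw [Polynomial.aeval_def]
    have := Polynomial.integralNormalization_eval₂_leadingCoeff_mul hdeg (algebraMap ℤ K) θ
    rw [hθ, mul_zero, eq_intCast] at this
    exact this
  have hmonic := Polynomial.monic_integralNormalization hF0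
  have hint : IsIntegral ℤ ((F.leadingCoeff : K) * θ) := ⟨_, hmonic, hroot⟩
  obtain ⟨η, hηK⟩ : ∃ η : 𝓞 K, (η : K) = (F.leadingCoeff : K) * θ := ⟨⟨_, hint⟩, rfl⟩
  have hlcK : (F.leadingCoeff : K) ≠ 0 := by exact_mod_cast hlc
  have hadj : Algebra.adjoin ℚ {(η : K)} = ⊤ := by
    rw [eq_top_iff, ← htop]
    apply Algebra.adjoin_le
    rw [Set.singleton_subset_iff]
    have : θ = ((F.leadingCoeff : ℚ)⁻¹) • (η : K) := by
      rw [hηK, Algebra.smul_def]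
      simp [hlcK]
    have h2 := Subalgebra.smul_mem (Algebra.adjoin ℚ {(η : K)})
      (Algebra.subset_adjoin (Set.mem_singleton (η : K))) ((F.leadingCoeff : ℚ)⁻¹)
    rw [← this] at h2
    exact h2
  have hmin : minpoly ℤ η = F.integralNormalization := by
    have hdvd : minpoly ℤ η ∣ F.integralNormalization := by
      refine minpoly.isIntegrallyClosed_dvd (R := ℤ) (s := η) (RingOfIntegers.isIntegral η) ?_
      apply RingOfIntegers.coe_injective
      have := Polynomial.aeval_algebraMap_apply K η F.integralNormalization
      rw [map_zero, ← this]
      rw [← hηK] at hroot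
      exact hroot
    refine (Polynomial.eq_of_monic_of_dvd_of_natDegree_le (minpoly.monic η.isIntegral) hmonic hdvd ?_).symm
    rw [Polynomial.natDegree_integralNormalization]
    have h1 : (minpoly ℚ (η:K)).natDegree = Module.finrank ℚ K := by
      rw [← Field.primitive_element_iff_minpoly_natDegree_eq]
      rw [eq_top_iff]
      intro y _
      have : y ∈ Algebra.adjoin ℚ {(η:K)} := by rw [hadj]; trivial
      exact IntermediateField.algebra_adjoin_le_adjoin ℚ _ this
    have h2 : minpoly ℚ (η:K) = (minpoly ℤ η).map (algebraMap ℤ ℚ) :=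
      minpoly.isIntegrallyClosed_eq_field_fractions ℚ K η.isIntegral
    rw [h2, Polynomial.natDegree_map_eq_of_injective (algebraMap ℤ ℚ).injective_int, h3] at h1
    exact h1.ge
  have hexp := exponent_ne_zero η hadj
  set B := RingOfIntegers.exponent η * F.leadingCoeff.natAbs with hB
  have hB0 : B ≠ 0 := mul_ne_zero hexp (by simpa using hlc)
  have hgood : ∀ p : ℕ, p.Prime → p ∉ B.primeFactors →
      WW (𝓞 K) p / p = ((rootCount F p : ℝ) / p) * Real.log p := by
    intro p hp hpB
    have : Fact p.Prime := ⟨hp⟩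
    have hnd : ¬ p ∣ B := fun h => hpB (Nat.mem_primeFactors.mpr ⟨hp, h, hB0⟩)
    have h1 : ¬ p ∣ RingOfIntegers.exponent η := fun h => hnd (Dvd.dvd.mul_right h _)
    have h2 : ((F.leadingCoeff : ℤ) : ZMod p) ≠ 0 := by
      rw [Ne, ZMod.intCast_zmod_eq_zero_iff_dvd]
      intro h
      exact hnd (Dvd.dvd.mul_left (Int.natCast_dvd.mp h) _)
    rw [WW_prime p hp, card_primes_eq_roots η p h1, hmin, rootCount_eq_ncard F hdeg p h2]
    ring
  obtain ⟨M, hM⟩ := field_mertens K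
  refine ⟨M + ∑ p ∈ B.primeFactors, |((rootCount F p : ℝ) / p) * Real.log p - WW (𝓞 K) p / p|, ?_⟩
  intro x hx
  set T := (Finset.Icc 1 ⌊x⌋₊).filter Nat.Prime
  have hd : |∑ p ∈ T, ((rootCount F p : ℝ) / p) * Real.log p - ∑ p ∈ T, WW (𝓞 K) p / p| ≤
      ∑ p ∈ B.primeFactors, |((rootCount F p : ℝ) / p) * Real.log p - WW (𝓞 K) p / p| := by
    rw [← Finset.sum_sub_distrib]
    refine (Finset.abs_sum_le_sum_abs _ _).trans ?_
    rw [← Finset.sum_filter_add_sum_filter_not T (fun p => p ∈ B.primeFactors)]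
    have hz : ∑ p ∈ T.filter (fun p => p ∉ B.primeFactors),
        |((rootCount F p : ℝ) / p) * Real.log p - WW (𝓞 K) p / p| = 0 := by
      apply Finset.sum_eq_zero
      intro p hp
      rw [Finset.mem_filter] at hp
      rw [hgood p (Finset.mem_filter.mp hp.1).2 hp.2, sub_self, abs_zero]
    rw [hz, add_zero]
    apply Finset.sum_le_sum_of_subset_of_nonneg
    · intro p hp; exact (Finset.mem_filter.mp hp).2
    · intros; positivity
  have := abs_sub_le (∑ p ∈ T, ((rootCount F p : ℝ) / p) * Real.log p) (∑ p ∈ T, WW (𝓞 K) p / p) (Real.log x)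
  linarith [hM x hx]
end roots2

section rc

lemma dvd_eval_congr (F : Polynomial ℤ) {d a b : ℤ} (h : d ∣ a - b) :
    d ∣ F.eval a ↔ d ∣ F.eval b := by
  have h1 : d ∣ F.eval a - F.eval b := h.trans (Polynomial.sub_dvd_eval_sub a b F)
  constructor
  · intro h2
    have := dvd_sub h2 h1
    simpa using this
  · intro h2
    have := dvd_add h1 h2
    simpa using this

lemma dvd_eval_mod (F : Polynomial ℤ) (d m r : ℕ) (hd : d ∣ m) :
    (d:ℤ) ∣ F.eval ((r % m : ℕ) : ℤ) ↔ (d:ℤ) ∣ F.eval (r:ℤ) := by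
  apply dvd_eval_congr
  have : (m:ℤ) ∣ ((r % m : ℕ) : ℤ) - r := by
    rw [Int.natCast_mod]
    exact dvd_sub_comm.mp Int.dvd_self_sub_emod
  exact (Int.natCast_dvd_natCast.mpr hd).trans this

lemma rootCount_one (F : Polynomial ℤ) : rootCount F 1 = 1 := by
  simp [rootCount]

lemma rootCount_le (F : Polynomial ℤ) (d : ℕ) : rootCount F d ≤ d := by
  refine (Finset.card_filter_le _ _).trans ?_
  simp

lemma rootCount_mul (F : Polynomial ℤ) (m n : ℕ) (h : Nat.Coprime m n) :
    rootCount F (m * n) = rootCount F m * rootCount F n := by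
  rcases Nat.eq_zero_or_pos m with rfl | hm
  · have : n = 1 := by simpa using h
    simp [rootCount]
  rcases Nat.eq_zero_or_pos n with rfl | hn
  · simp [rootCount]
  rw [rootCount, rootCount, rootCount, ← Finset.card_product]
  have hdv : ∀ r : ℕ, (((m * n : ℕ) : ℤ) ∣ F.eval (r:ℤ)) ↔ (m:ℤ) ∣ F.eval (r:ℤ) ∧ (n:ℤ) ∣ F.eval (r:ℤ) := by
    intro r
    constructor
    · intro h; push_cast at h
      exact ⟨(Dvd.intro _ rfl).trans h, (Dvd.intro_left _ rfl).trans h⟩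
    · rintro ⟨h1, h2⟩
      push_cast
      exact IsCoprime.mul_dvd (Nat.isCoprime_iff_coprime.mpr h) h1 h2
  refine Finset.card_bij (fun r _ => (r % m, r % n)) ?_ ?_ ?_
  · intro r hr
    simp only [Finset.mem_filter, Finset.mem_range, Finset.mem_product] at hr ⊢
    rw [dvd_eval_mod F m m r dvd_rfl, dvd_eval_mod F n n r dvd_rfl]
    have := (hdv r).mp hr.2
    exact ⟨⟨Nat.mod_lt _ hm, this.1⟩, ⟨Nat.mod_lt _ hn, this.2⟩⟩
  · intro r hr s hs hrs
    simp only [Finset.mem_filter, Finset.mem_range, Prod.mk.injEq] at hr hs hrs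
    have : r ≡ s [MOD m * n] := (Nat.modEq_and_modEq_iff_modEq_mul h).mp hrs
    exact Nat.ModEq.eq_of_lt_of_lt this hr.1 hs.1
  · rintro ⟨a, b⟩ hab
    simp only [Finset.mem_filter, Finset.mem_range, Finset.mem_product] at hab
    obtain ⟨⟨ha, ha'⟩, ⟨hb, hb'⟩⟩ := hab
    have hc := (Nat.chineseRemainder h a b).2
    have hlt := Nat.chineseRemainder_lt_mul h a b hm.ne' hn.ne'
    set c : ℕ := (Nat.chineseRemainder h a b : ℕ) with hcdef
    have h1 : c % m = a := by have := hc.1; rwa [Nat.ModEq, Nat.mod_eq_of_lt ha] at this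
    have h2 : c % n = b := by have := hc.2; rwa [Nat.ModEq, Nat.mod_eq_of_lt hb] at this
    refine ⟨c, ?_, by simp [h1, h2]⟩
    simp only [Finset.mem_filter, Finset.mem_range]
    refine ⟨hlt, (hdv c).mpr ⟨?_, ?_⟩⟩
    · rw [← dvd_eval_mod F m m c dvd_rfl, h1]; exact ha'
    · rw [← dvd_eval_mod F n n c dvd_rfl, h2]; exact hb'

lemma bezout_poly (F : Polynomial ℤ) (hirr : Irreducible (F.map (algebraMap ℤ ℚ))) :
    ∃ R : ℤ, R ≠ 0 ∧ ∀ s : ℤ, ∀ d : ℤ, d ∣ F.eval s → d ∣ F.derivative.eval s → d ∣ R := by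
  obtain ⟨u, v, huv⟩ := hirr.separable
  obtain ⟨b, hb, hU⟩ := IsLocalization.integerNormalization_spec (nonZeroDivisors ℤ) u
  obtain ⟨c, hc, hV⟩ := IsLocalization.integerNormalization_spec (nonZeroDivisors ℤ) v
  set U := IsLocalization.integerNormalization (nonZeroDivisors ℤ) u
  set V := IsLocalization.integerNormalization (nonZeroDivisors ℤ) v
  have key : Polynomial.C c * U * F + Polynomial.C b * V * F.derivative = Polynomial.C (b * c) := by
    apply Polynomial.map_injective (algebraMap ℤ ℚ) (algebraMap ℤ ℚ).injective_int
    rw [Polynomial.map_add, Polynomial.map_mul, Polynomial.map_mul, Polynomial.map_mul,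
      Polynomial.map_mul, hU, hV, ← Polynomial.derivative_map]
    simp only [zsmul_eq_mul, eq_intCast, Polynomial.map_mul, Polynomial.map_intCast, Int.cast_mul]
    linear_combination ((b : Polynomial ℚ) * c) * huv
  refine ⟨b * c, mul_ne_zero (nonZeroDivisors.ne_zero hb) (nonZeroDivisors.ne_zero hc), ?_⟩
  intro s d h1 h2
  have := congrArg (Polynomial.eval s) key
  simp only [Polynomial.eval_add, Polynomial.eval_mul, Polynomial.eval_C] at this
  rw [← this]
  exact dvd_add (h1.mul_left _) (h2.mul_left _)

lemma pow_dvd_left (p : ℤ) (hp : Prime p) (ρ : ℕ) : ∀ (k : ℕ) (x y : ℤ), p ^ k ∣ x * y →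
    ¬ p ^ (ρ + 1) ∣ y → p ^ (k - ρ) ∣ x := by
  induction ρ with
  | zero =>
    intro k x y h hy
    exact hp.pow_dvd_of_dvd_mul_right k (by simpa using hy) h
  | succ ρ ih =>
    intro k x y h hy
    rcases k with _ | k
    · simp
    by_cases hpy : p ∣ y
    · obtain ⟨z, rfl⟩ := hpy
      have h1 : p ^ k ∣ x * z := by
        rw [pow_succ', show x * (p * z) = p * (x * z) by ring] at h
        exact (mul_dvd_mul_iff_left hp.ne_zero).mp h
      have h2 : ¬ p ^ (ρ + 1) ∣ z := by
        intro h3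
        apply hy
        rw [pow_succ']
        exact mul_dvd_mul_left _ h3
      have := ih k x z h1 h2
      simpa using this
    · have := hp.pow_dvd_of_dvd_mul_right (k+1) hpy h
      exact (pow_dvd_pow _ (by omega)).trans this

lemma rootCount_prime_le (F : Polynomial ℤ) (p : ℕ) (hp : p.Prime)
    (h : ¬ ∀ s : ℤ, (p:ℤ) ∣ F.eval s ∧ (p:ℤ) ∣ F.derivative.eval s) :
    rootCount F p ≤ F.natDegree := by
  have : Fact p.Prime := ⟨hp⟩
  set G := F.map (Int.castRingHom (ZMod p)) with hG
  have hev : ∀ (H : Polynomial ℤ) (s : ℤ), (H.map (Int.castRingHom (ZMod p))).eval (s : ZMod p) =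
      ((H.eval s : ℤ) : ZMod p) := by
    intro H s
    rw [Polynomial.eval_map]
    have := Polynomial.eval₂_at_apply (p := H) (Int.castRingHom (ZMod p)) s
    simpa using this
  have hG0 : G ≠ 0 := by
    intro h0
    apply h
    intro s
    rw [← ZMod.intCast_zmod_eq_zero_iff_dvd, ← ZMod.intCast_zmod_eq_zero_iff_dvd, ← hev, ← hev,
      ← Polynomial.derivative_map, ← hG, h0]
    simp
  calc rootCount F p ≤ G.roots.toFinset.card := by
        rw [rootCount]
        refine Finset.card_le_card_of_injOn (fun r => (r : ZMod p)) ?_ ?_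
        · intro r hr
          simp only [Finset.coe_filter, Finset.mem_range] at hr
          have h2 := hr.2
          rw [← ZMod.intCast_zmod_eq_zero_iff_dvd, ← hev] at h2
          simp only [Multiset.mem_toFinset, SetLike.mem_coe, Polynomial.mem_roots hG0]
          have h3 : G.eval (((r:ℤ)) : ZMod p) = 0 := h2
          rwa [Int.cast_natCast] at h3
        · intro r hr s hs hrs
          simp only [Finset.coe_filter, Finset.mem_range] at hr hs
          have hrs : (r : ZMod p) = (s : ZMod p) := hrs
          rw [ZMod.natCast_eq_natCast_iff'] at hrs
          rwa [Nat.mod_eq_of_lt hr.1, Nat.mod_eq_of_lt hs.1] at hrs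
    _ ≤ Multiset.card G.roots := Multiset.toFinset_card_le _
    _ ≤ G.natDegree := Polynomial.card_roots' _
    _ ≤ _ := Polynomial.natDegree_map_le

lemma rootCount_pp_step (F : Polynomial ℤ) (p : ℕ) (hp : p.Prime) (R : ℤ)
    (hR : ∀ s : ℤ, ∀ d : ℤ, d ∣ F.eval s → d ∣ F.derivative.eval s → d ∣ R) (ρ : ℕ)
    (hρ : ¬ (p:ℤ) ^ (ρ + 1) ∣ R) (k : ℕ) (hk : ρ + 1 ≤ k) :
    rootCount F (p ^ k) ≤ rootCount F (p ^ (ρ + 1)) * p ^ ρ := by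
  have hpi : Prime (p:ℤ) := Nat.prime_iff_prime_int.mp hp
  rw [rootCount, rootCount, ← Finset.card_range (p ^ ρ), ← Finset.card_product]
  refine Finset.card_le_card_of_injOn (fun r => (r % p ^ (ρ+1), r / p ^ (k - ρ))) ?_ ?_
  · intro r hr
    simp only [Finset.coe_filter, Finset.mem_range] at hr
    simp only [Finset.coe_product, Set.mem_prod, Finset.coe_filter, Finset.mem_range,
      Finset.coe_range, Set.mem_Iio]
    refine ⟨⟨Nat.mod_lt _ (pow_pos hp.pos _), ?_⟩, ?_⟩
    · rw [dvd_eval_mod F _ _ r dvd_rfl]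
      refine dvd_trans ?_ hr.2
      exact_mod_cast pow_dvd_pow p hk
    · apply Nat.div_lt_of_lt_mul
      rw [← pow_add]
      have : k - ρ + ρ = k := by omega
      rw [this]; exact hr.1
  · intro r hr s hs hrs
    simp only [Finset.coe_filter, Finset.mem_range] at hr hs
    simp only [Prod.mk.injEq] at hrs
    obtain ⟨h1, h2⟩ := hrs
    have h1' : ((p:ℤ) ^ (ρ+1)) ∣ (r:ℤ) - s := by
      have := (Nat.modEq_iff_dvd.mp (show s ≡ r [MOD p ^ (ρ+1)] from h1.symm))
      exact_mod_cast this
    obtain ⟨q, hq⟩ := Polynomial.binomExpansion F (s:ℤ) ((r:ℤ) - s)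
    rw [add_sub_cancel] at hq
    have hr2 : (p:ℤ) ^ k ∣ F.eval (r:ℤ) := by exact_mod_cast hr.2
    have hs2 : (p:ℤ) ^ k ∣ F.eval (s:ℤ) := by exact_mod_cast hs.2
    have h3 : (p:ℤ) ^ k ∣ ((r:ℤ) - s) * (F.derivative.eval (s:ℤ) + q * ((r:ℤ) - s)) := by
      have := dvd_sub hr2 hs2
      have e : ((r:ℤ) - s) * (F.derivative.eval (s:ℤ) + q * ((r:ℤ) - s)) =
          F.eval (r:ℤ) - F.eval (s:ℤ) := by linear_combination -hq
      rw [e]; exact this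
    have h4 : ¬ (p:ℤ) ^ (ρ+1) ∣ F.derivative.eval (s:ℤ) + q * ((r:ℤ) - s) := by
      intro h5
      apply hρ
      refine hR s _ ((pow_dvd_pow _ hk).trans hs2) ?_
      exact (dvd_add_left (h1'.mul_left q)).mp h5
    have h5 := pow_dvd_left p hpi ρ k _ _ h3 h4
    have h6 : s ≡ r [MOD p ^ (k - ρ)] := by
      rw [Nat.modEq_iff_dvd]; exact_mod_cast h5
    rw [← Nat.div_add_mod r (p ^ (k - ρ)), ← Nat.div_add_mod s (p ^ (k - ρ)), h2]
    congr 1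
    exact h6.symm

lemma rootCount_pp (F : Polynomial ℤ) (hirr : Irreducible (F.map (algebraMap ℤ ℚ))) :
    ∃ C : ℕ, 1 ≤ C ∧ ∀ p k : ℕ, p.Prime → rootCount F (p ^ k) ≤ C := by
  obtain ⟨R, hR0, hR⟩ := bezout_poly F hirr
  refine ⟨F.natDegree + R.natAbs ^ 3 + 1, by omega, ?_⟩
  intro p k hp
  have hpi : Prime (p:ℤ) := Nat.prime_iff_prime_int.mp hp
  have hRn : R.natAbs ≠ 0 := by simpa using hR0
  set ρ := R.natAbs.factorization p with hρ
  have h1 : p ^ ρ ∣ R.natAbs := Nat.ordProj_dvd _ _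
  have h2 : ¬ p ^ (ρ + 1) ∣ R.natAbs := Nat.pow_succ_factorization_not_dvd hRn hp
  have h2' : ¬ (p:ℤ) ^ (ρ + 1) ∣ R := by
    intro h; apply h2; rw [← Int.natCast_dvd]; exact_mod_cast h
  have h3 : p ^ ρ ≤ R.natAbs := Nat.le_of_dvd (Nat.pos_of_ne_zero hRn) h1
  have h33 : R.natAbs ≤ R.natAbs ^ 3 := Nat.le_self_pow (by norm_num) _
  by_cases hk : ρ + 1 ≤ k
  · have h4 := rootCount_pp_step F p hp R hR ρ h2' k hk
    rcases Nat.eq_zero_or_pos ρ with h0 | hpos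
    · rw [h0] at h4 h2'
      simp only [zero_add, pow_one, pow_zero, mul_one] at h4 h2'
      have h5 := rootCount_prime_le F p hp (fun h => h2' (hR 0 _ (h 0).1 (h 0).2))
      omega
    · have h5 := rootCount_le F (p ^ (ρ + 1))
      have h6 : p ^ (ρ+1) ≤ R.natAbs ^ 2 := by
        calc p ^ (ρ+1) ≤ p ^ (ρ * 2) := Nat.pow_le_pow_right hp.pos (by omega)
          _ = (p ^ ρ)^2 := by rw [pow_mul]
          _ ≤ _ := Nat.pow_le_pow_left h3 2
      have h7 : rootCount F (p ^ (ρ + 1)) * p ^ ρ ≤ R.natAbs ^ 2 * R.natAbs :=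
        Nat.mul_le_mul (h5.trans h6) h3
      have : R.natAbs ^ 2 * R.natAbs = R.natAbs ^ 3 := by ring
      omega
  · have h4 := rootCount_le F (p ^ k)
    have : p ^ k ≤ p ^ ρ := Nat.pow_le_pow_right hp.pos (by omega)
    omega

lemma rootCount_bound (F : Polynomial ℤ) (hirr : Irreducible (F.map (algebraMap ℤ ℚ))) :
    ∃ C : ℕ, 1 ≤ C ∧ ∀ d : ℕ, 1 ≤ d → rootCount F d ≤ C ^ d.primeFactors.card := by
  obtain ⟨C, hC, h⟩ := rootCount_pp F hirr
  refine ⟨C, hC, ?_⟩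
  intro d
  induction d using Nat.recOnPosPrimePosCoprime with
  | zero => intro h; omega
  | one => intro _; simp [rootCount_one]
  | prime_pow p n hp hn =>
    intro _
    rw [Nat.primeFactors_prime_pow hn.ne' hp]
    simpa using h p n hp
  | coprime a b ha hb hab iha ihb =>
    intro _
    rw [rootCount_mul F a b hab, hab.primeFactors_mul,
      Finset.card_union_of_disjoint hab.disjoint_primeFactors, pow_add]
    exact Nat.mul_le_mul (iha (by omega)) (ihb (by omega))

lemma card_primeFactors_le (d : ℕ) : d.primeFactors.card ≤ bigOmega d :=
  List.toFinset_card_le _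

lemma pow_omega_le (C : ℕ) (hC : 1 ≤ C) (ε : ℝ) (hε : 0 < ε) :
    ∃ K : ℝ, 1 ≤ K ∧ ∀ d : ℕ, 1 ≤ d → (C:ℝ) ^ d.primeFactors.card ≤ K * (d:ℝ) ^ ε := by
  have hCr : (1:ℝ) ≤ C := by exact_mod_cast hC
  obtain ⟨P, hP⟩ := exists_nat_ge ((C:ℝ) ^ (1/ε))
  have hP' : ∀ p : ℕ, P ≤ p → (C:ℝ) ≤ (p:ℝ)^ε := by
    intro p hp
    have : (C:ℝ) ^ (1/ε) ≤ p := hP.trans (by exact_mod_cast hp)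
    have h2 := Real.rpow_le_rpow (by positivity) this hε.le
    rwa [← Real.rpow_mul (by positivity), one_div, inv_mul_cancel₀ hε.ne', Real.rpow_one] at h2
  refine ⟨(C:ℝ)^P, one_le_pow₀ hCr, ?_⟩
  intro d hd
  have h1 : (C:ℝ) ^ d.primeFactors.card ≤
      ∏ p ∈ d.primeFactors, ((if p < P then (C:ℝ) else 1) * (p:ℝ)^ε) := by
    rw [← Finset.prod_const]
    apply Finset.prod_le_prod
    · intros; positivity
    · intro p hp
      have hp1 : (1:ℝ) ≤ p := by exact_mod_cast (Nat.prime_of_mem_primeFactors hp).one_le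
      split_ifs with h
      · have := Real.one_le_rpow hp1 hε.le
        nlinarith
      · rw [one_mul]; exact hP' p (by omega)
  refine h1.trans ?_
  rw [Finset.prod_mul_distrib]
  apply mul_le_mul _ _ (by positivity) (by positivity)
  · rw [← Finset.prod_filter, Finset.prod_const]
    apply pow_le_pow_right₀ hCr
    calc _ ≤ (Finset.range P).card := Finset.card_le_card (by
          intro p hp; simp only [Finset.mem_filter] at hp; simpa using hp.2)
      _ = P := by simp
  · rw [Real.finsetProd_rpow _ _ (by intros; positivity)]
    apply Real.rpow_le_rpow (by positivity) _ hε.le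
    have := Nat.le_of_dvd (by omega) (Nat.prod_primeFactors_dvd d)
    have h2 : ((∏ p ∈ d.primeFactors, p : ℕ) : ℝ) ≤ d := by exact_mod_cast this
    rwa [Nat.cast_prod] at h2
end rc

section cnt

lemma growth (F : Polynomial ℤ) (hdeg : 1 ≤ F.natDegree) (hlead : 0 < F.leadingCoeff) :
    ∃ (m0 : ℕ) (c B : ℝ), 1 ≤ m0 ∧ 0 < c ∧ 0 < B ∧
      (∀ m n : ℕ, m0 ≤ m → m < n → F.eval (m:ℤ) < F.eval (n:ℤ)) ∧
      (∀ m : ℕ, m0 ≤ m → 0 < F.eval (m:ℤ)) ∧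
      (∀ m : ℕ, m0 ≤ m → c * (m:ℝ) ^ F.natDegree ≤ ((F.eval (m:ℤ) : ℤ) : ℝ)) ∧
      (∀ m : ℕ, 1 ≤ m → ((F.eval (m:ℤ) : ℤ) : ℝ) ≤ B * (m:ℝ) ^ F.natDegree) := by
  set f : Polynomial ℝ := F.map (Int.castRingHom ℝ) with hf
  have hev : ∀ m : ℕ, ((F.eval (m:ℤ) : ℤ) : ℝ) = f.eval (m:ℝ) := by
    intro m
    rw [hf, Polynomial.eval_map]
    have := Polynomial.eval₂_at_apply (p := F) (Int.castRingHom ℝ) (m:ℤ)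
    simpa using this.symm
  have hinj : Function.Injective (Int.castRingHom ℝ) := Int.cast_injective
  have hfd : f.natDegree = F.natDegree := Polynomial.natDegree_map_eq_of_injective hinj F
  have hfl : f.leadingCoeff = (F.leadingCoeff : ℝ) := by
    rw [hf, Polynomial.leadingCoeff_map_of_injective hinj]; simp
  have hl0 : (0:ℝ) < F.leadingCoeff := by exact_mod_cast hlead
  have hf0 : f ≠ 0 := by
    intro h; rw [h] at hfl; simp at hfl; linarith [hl0, hfl]
  -- derivative eventually positive
  have hder : ∀ᶠ x : ℝ in atTop, 0 < f.derivative.eval x := by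
    have hlc : 0 < f.derivative.leadingCoeff := by
      rw [Polynomial.leadingCoeff_derivative, hfl, hfd]
      have : (0:ℝ) < F.natDegree := by exact_mod_cast hdeg
      first | positivity | (simp; positivity)
    by_cases hd : 0 < f.derivative.degree
    · exact (Polynomial.tendsto_atTop_of_leadingCoeff_nonneg _ hd hlc.le).eventually_gt_atTop 0
    · have := Polynomial.eq_C_of_degree_le_zero (not_lt.mp hd)
      rw [this] at hlc ⊢
      simp at hlc
      simp [hlc]
  have hrat : ∀ᶠ x : ℝ in atTop, (F.leadingCoeff : ℝ) / 2 < f.eval x / x ^ F.natDegree := by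
    have := Polynomial.div_tendsto_atTop_leadingCoeff_div_of_degree_eq f (Polynomial.X ^ F.natDegree)
      (by rw [Polynomial.degree_X_pow, Polynomial.degree_eq_natDegree hf0, hfd])
    simp only [Polynomial.eval_pow, Polynomial.eval_X, Polynomial.leadingCoeff_X_pow, div_one, hfl]
      at this
    exact this.eventually_const_lt (by linarith)
  obtain ⟨X0, hX0⟩ := Filter.eventually_atTop.mp (hder.and hrat)
  obtain ⟨m1, hm1⟩ := exists_nat_ge X0
  set m0 := m1 + 1
  have hm : ∀ m : ℕ, m0 ≤ m → X0 ≤ (m:ℝ) := fun m h =>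
    hm1.trans (by exact_mod_cast (by omega : m1 ≤ m))
  have hlow : ∀ m : ℕ, m0 ≤ m → (F.leadingCoeff : ℝ) / 2 * (m:ℝ) ^ F.natDegree ≤ ((F.eval (m:ℤ) : ℤ) : ℝ) := by
    intro m h
    have h1 := (hX0 m (hm m h)).2
    have hmpos : (0:ℝ) < (m:ℝ) ^ F.natDegree := by
      have : (0:ℝ) < m := by exact_mod_cast (by omega : 0 < m)
      positivity
    rw [lt_div_iff₀ hmpos] at h1
    rw [hev]; exact h1.le
  refine ⟨m0, (F.leadingCoeff : ℝ) / 2, ∑ i ∈ range (F.natDegree + 1), |(F.coeff i : ℝ)| + 1,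
    by omega, by positivity, by positivity, ?_, ?_, hlow, ?_⟩
  · intro m n h1 h2
    have hsm : StrictMonoOn (fun x => f.eval x) (Set.Ici X0) := by
      apply strictMonoOn_of_deriv_pos (convex_Ici X0) f.continuous.continuousOn
      intro x hx
      rw [interior_Ici] at hx
      rw [Polynomial.deriv]
      exact (hX0 x (le_of_lt hx)).1
    have := hsm (hm m h1) (hm n (by omega)) (by exact_mod_cast h2 : (m:ℝ) < n)
    simp only at this
    rw [← hev, ← hev] at this
    exact_mod_cast this
  · intro m h
    have h1 := hlow m h
    have hmpos : (0:ℝ) < m := by exact_mod_cast (by omega : 0 < m)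
    have : (0:ℝ) < ((F.eval (m:ℤ) : ℤ) : ℝ) := lt_of_lt_of_le (by positivity) h1
    exact_mod_cast this
  · intro m h
    have hm1' : (1:ℝ) ≤ m := by exact_mod_cast h
    rw [Polynomial.eval_eq_sum_range]
    push_cast
    calc ∑ i ∈ range (F.natDegree + 1), (F.coeff i : ℝ) * (m:ℝ)^i
        ≤ ∑ i ∈ range (F.natDegree + 1), |(F.coeff i : ℝ)| * (m:ℝ)^F.natDegree := by
          apply Finset.sum_le_sum
          intro i hi
          have hi' : i ≤ F.natDegree := by simpa [Nat.lt_succ_iff] using hi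
          have h1 : (m:ℝ)^i ≤ (m:ℝ)^F.natDegree := pow_le_pow_right₀ hm1' hi'
          calc (F.coeff i : ℝ) * (m:ℝ)^i ≤ |(F.coeff i : ℝ)| * (m:ℝ)^i := by
                gcongr; exact le_abs_self _
            _ ≤ _ := by gcongr
      _ = (∑ i ∈ range (F.natDegree + 1), |(F.coeff i : ℝ)|) * (m:ℝ)^F.natDegree := by
          rw [Finset.sum_mul]
      _ ≤ _ := by gcongr; linarith

lemma periodic_count (p : ℕ → Prop) (d : ℕ) (hd : 1 ≤ d) (hp : Function.Periodic p d) (T : ℕ) :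
    |(((range T).filter p).card : ℝ) - (((range d).filter p).card : ℝ) / d * T| ≤
      ((range d).filter p).card := by
  set h := ((range d).filter p).card with hh
  have hq : ∀ q : ℕ, ((range (d * q)).filter p).card = q * h := by
    intro q
    induction q with
    | zero => simp
    | succ q ih =>
      have h1 := Nat.filter_Ico_card_eq_of_periodic (d * q) d p hp
      rw [Nat.count_eq_card_filter_range, ← hh] at h1
      have h2 : range (d * (q + 1)) = range (d * q) ∪ Ico (d * q) (d * q + d) := by
        ext j; simp only [Finset.mem_range, Finset.mem_union, Finset.mem_Ico]
        rw [Nat.mul_succ]; omega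
      rw [h2, Finset.filter_union, Finset.card_union_of_disjoint, ih, h1]
      · ring
      · apply Finset.disjoint_filter_filter
        rw [Finset.disjoint_left]
        intro j; simp only [Finset.mem_range, Finset.mem_Ico]; omega
  set q := T / d
  have e : d * q + T % d = T := Nat.div_add_mod T d
  have hlt := Nat.mod_lt T hd
  have hl : d * q ≤ T := by omega
  have hu : T ≤ d * (q + 1) := by rw [Nat.mul_succ]; omega
  have c1 : q * h ≤ ((range T).filter p).card := by
    rw [← hq q]
    exact Finset.card_le_card (Finset.filter_subset_filter _ (Finset.range_subset_range.mpr hl))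
  have c2 : ((range T).filter p).card ≤ (q + 1) * h := by
    rw [← hq (q + 1)]
    exact Finset.card_le_card (Finset.filter_subset_filter _ (Finset.range_subset_range.mpr hu))
  have c1' : (q:ℝ) * h ≤ ((range T).filter p).card := by exact_mod_cast c1
  have c2' : (((range T).filter p).card : ℝ) ≤ (q + 1) * h := by exact_mod_cast c2
  have hdr : (0:ℝ) < d := by exact_mod_cast hd
  have hl' : (d:ℝ) * q ≤ T := by exact_mod_cast hl
  have hu' : (T:ℝ) ≤ d * (q + 1) := by exact_mod_cast hu
  have hh0 : (0:ℝ) ≤ h := by positivity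
  have g1 : (q:ℝ) * h ≤ (h:ℝ) / d * T := by
    rw [div_mul_eq_mul_div, le_div_iff₀ hdr]; nlinarith
  have g2 : (h:ℝ) / d * T ≤ (q + 1) * h := by
    rw [div_mul_eq_mul_div, div_le_iff₀ hdr]; nlinarith
  rw [abs_le]; constructor <;> linarith
end cnt

noncomputable def polySeq (F : Polynomial ℤ) : ℕ → ℝ :=
  fun n => if 1 ≤ n ∧ ∃ m : ℕ, 1 ≤ m ∧ F.eval (m : ℤ) = (n : ℤ) then 1 else 0

lemma polyNd_card (F : Polynomial ℤ) (d : ℕ) (x : ℝ) :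
    Nd (polySeq F) d x = ((((Finset.Icc 1 ⌊x⌋₊).filter (fun n => d ∣ n)).filter
      (fun n : ℕ => 1 ≤ n ∧ ∃ m : ℕ, 1 ≤ m ∧ F.eval (m : ℤ) = (n : ℤ))).card : ℝ) := by
  unfold Nd polySeq
  rw [Finset.sum_boole]

lemma polyN_eq (F : Polynomial ℤ) (x : ℝ) : N (polySeq F) x = Nd (polySeq F) 1 x := by
  unfold N Nd
  simp

lemma root_shift (F : Polynomial ℤ) (d m0 : ℕ) :
    Function.Periodic (fun j : ℕ => (d:ℤ) ∣ F.eval ((m0 + j : ℕ):ℤ)) d ∧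
    ((range d).filter (fun j : ℕ => (d:ℤ) ∣ F.eval ((m0 + j : ℕ):ℤ))).card = rootCount F d := by
  have hper : Function.Periodic (fun j : ℕ => (d:ℤ) ∣ F.eval ((j : ℕ):ℤ)) d := by
    intro j
    simp only [eq_iff_iff]
    apply dvd_eval_congr
    push_cast; simp
  refine ⟨?_, ?_⟩
  · intro j
    have := hper (m0 + j)
    simpa [add_assoc] using this
  · have h1 := Nat.filter_Ico_card_eq_of_periodic m0 d _ hper
    rw [Nat.count_eq_card_filter_range] at h1
    unfold rootCount
    rw [← Nat.Ico_zero_eq_range]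
    calc _ = ((Ico m0 (m0+d)).filter (fun j : ℕ => (d:ℤ) ∣ F.eval ((j : ℕ):ℤ))).card := by
          apply Finset.card_bij (fun j _ => m0 + j)
          · intro a ha; simp at ha ⊢; exact ⟨ha.1, ha.2⟩
          · intro a _ b _ h; omega
          · intro b hb
            simp only [Finset.mem_filter, Finset.mem_Ico] at hb
            refine ⟨b - m0, ?_, by omega⟩
            simp only [Finset.mem_filter, Finset.mem_Ico]
            refine ⟨by omega, ?_⟩
            rw [show m0 + (b - m0) = b by omega]; exact hb.2
      _ = _ := by rw [h1, Nat.Ico_zero_eq_range]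

lemma poly_count (F : Polynomial ℤ) (hdeg : 1 ≤ F.natDegree) (hlead : 0 < F.leadingCoeff) :
    ∃ (m0 : ℕ) (c B : ℝ), 0 < c ∧ 0 < B ∧ ∀ x : ℝ, 0 ≤ x → ∃ T : ℕ,
      c * (T:ℝ) ^ F.natDegree ≤ x ∧ x ≤ B * ((m0:ℝ) + T) ^ F.natDegree ∧
      ∀ d : ℕ, 1 ≤ d →
        |Nd (polySeq F) d x - (rootCount F d : ℝ) / d * T| ≤ rootCount F d + m0 := by
  obtain ⟨m0, c, B, hm0, hc, hB, hmono, hpos, hlow, hup⟩ := growth F hdeg hlead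
  refine ⟨m0, c, B, hc, hB, ?_⟩
  intro x hx
  set X := ⌊x⌋₊ with hX
  have hge : ∀ j : ℕ, (j:ℤ) ≤ F.eval ((m0 + j : ℕ) : ℤ) := by
    intro j
    induction j with
    | zero => exact (hpos _ (by omega)).le
    | succ j ih =>
      have := hmono (m0 + j) (m0 + (j+1)) (by omega) (by omega)
      push_cast at *; omega
  have hex : ∃ j : ℕ, (X:ℤ) < F.eval ((m0 + j : ℕ) : ℤ) :=
    ⟨X + 1, lt_of_lt_of_le (by push_cast; omega) (hge (X+1))⟩
  obtain ⟨T, hT, hTmin⟩ : ∃ T : ℕ, (X:ℤ) < F.eval ((m0 + T : ℕ) : ℤ) ∧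
      ∀ j < T, F.eval ((m0 + j : ℕ) : ℤ) ≤ X :=
    ⟨Nat.find hex, Nat.find_spec hex, fun j hj => not_lt.mp (Nat.find_min hex hj)⟩
  have hTmax : ∀ j, T ≤ j → (X:ℤ) < F.eval ((m0 + j : ℕ) : ℤ) := by
    intro j hj
    rcases hj.eq_or_lt with h | h
    · rw [← h]; exact hT
    · exact hT.trans (hmono _ _ (by omega) (by omega))
  have hXx : (X:ℝ) ≤ x := Nat.floor_le hx
  refine ⟨T, ?_, ?_, ?_⟩
  · rcases Nat.eq_zero_or_pos T with h | h
    · rw [h]; simp; rw [zero_pow (by omega)]; simpa using hx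
    · have h1 := hlow (m0 + (T - 1)) (by omega)
      have h2 : ((F.eval ((m0 + (T-1) : ℕ) : ℤ) : ℤ) : ℝ) ≤ X := by
        exact_mod_cast hTmin (T-1) (by omega)
      have h3 : (T:ℝ) ≤ ((m0 + (T-1) : ℕ):ℝ) := by exact_mod_cast (by omega)
      calc c * (T:ℝ) ^ F.natDegree ≤ c * ((m0 + (T-1) : ℕ):ℝ) ^ F.natDegree := by gcongr
        _ ≤ _ := h1
        _ ≤ _ := h2
        _ ≤ x := hXx
  · have h1 := hup (m0 + T) (by omega)
    have h2 : (X:ℝ) + 1 ≤ ((F.eval ((m0 + T : ℕ) : ℤ) : ℤ) : ℝ) := by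
      exact_mod_cast hT
    have h3 : x < X + 1 := Nat.lt_floor_add_one x
    push_cast at h1 h2
    linarith
  · intro d hd
    obtain ⟨hper, hcnt⟩ := root_shift F d m0
    have hpc : |(((range T).filter (fun j : ℕ => (d:ℤ) ∣ F.eval ((m0 + j : ℕ):ℤ))).card : ℝ) -
        (rootCount F d : ℝ) / d * T| ≤ rootCount F d := by
      rw [← hcnt]
      convert periodic_count _ d hd hper T
    rw [polyNd_card]
    set S := (((Finset.Icc 1 ⌊x⌋₊).filter (fun n => d ∣ n)).filter
      (fun n : ℕ => 1 ≤ n ∧ ∃ m : ℕ, 1 ≤ m ∧ F.eval (m : ℤ) = (n : ℤ))) with hS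
    set R := (range T).filter (fun j : ℕ => (d:ℤ) ∣ F.eval ((m0 + j : ℕ):ℤ)) with hR
    have hfpos : ∀ j : ℕ, 0 < F.eval ((m0 + j : ℕ):ℤ) := fun j => hpos _ (by omega)
    have l1 : R.card ≤ S.card := by
      apply Finset.card_le_card_of_injOn (fun j => (F.eval ((m0 + j : ℕ):ℤ)).toNat)
      · intro j hj
        simp only [hR, Finset.coe_filter, Set.mem_ofPred_eq, Finset.mem_range] at hj
        have h0 := hfpos j
        have h1 := hTmin j hj.1
        simp only [hS, Finset.coe_filter, Set.mem_ofPred_eq, Finset.mem_filter, Finset.mem_Icc]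
        refine ⟨⟨⟨by omega, by omega⟩, ?_⟩, by omega, m0 + j, by omega, by omega⟩
        rw [← Int.natCast_dvd_natCast, Int.toNat_of_nonneg h0.le]
        exact hj.2
      · intro a _ b _ hab
        simp only at hab
        have ha := hfpos a
        have hb := hfpos b
        by_contra hne
        rcases lt_or_gt_of_ne hne with h | h
        · have := hmono (m0+a) (m0+b) (by omega) (by omega); omega
        · have := hmono (m0+b) (m0+a) (by omega) (by omega); omega
    have l2 : S.card ≤ R.card + m0 := by
      have hsub : S ⊆ R.image (fun j : ℕ => (F.eval ((m0 + j : ℕ):ℤ)).toNat) ∪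
          (range m0).image (fun m : ℕ => (F.eval (m:ℤ)).toNat) := by
        intro n hn
        simp only [hS, Finset.mem_filter, Finset.mem_Icc] at hn
        obtain ⟨⟨⟨h1, h2⟩, h3⟩, _, m, hm, hmn⟩ := hn
        rw [Finset.mem_union]
        by_cases hmm : m < m0
        · right
          rw [Finset.mem_image]
          exact ⟨m, by simpa using hmm, by rw [hmn]; simp⟩
        · left
          rw [Finset.mem_image]
          have hem : m0 + (m - m0) = m := by omega
          refine ⟨m - m0, ?_, by rw [hem, hmn]; simp⟩
          rw [hR, Finset.mem_filter, Finset.mem_range]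
          refine ⟨?_, ?_⟩
          · by_contra hlt
            have := hTmax (m - m0) (by omega)
            rw [hem, hmn] at this
            omega
          · rw [hem, hmn]; exact_mod_cast h3
      calc S.card ≤ _ := Finset.card_le_card hsub
        _ ≤ _ := Finset.card_union_le _ _
        _ ≤ R.card + (range m0).card := add_le_add Finset.card_image_le Finset.card_image_le
        _ = _ := by simp
    have l1' : (R.card : ℝ) ≤ S.card := by exact_mod_cast l1
    have l2' : (S.card : ℝ) ≤ R.card + m0 := by exact_mod_cast l2
    have hm0' : (0:ℝ) ≤ m0 := by positivity
    rw [abs_le] at hpc ⊢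
    constructor <;> linarith [hpc.1, hpc.2]

lemma poly_summary (F : Polynomial ℤ) (hdeg : 1 ≤ F.natDegree) (hlead : 0 < F.leadingCoeff) :
    ∃ C1 : ℝ, 1 ≤ C1 ∧ ∀ x : ℝ, 0 ≤ x →
      N (polySeq F) x ≤ C1 * (x ^ (1 / (F.natDegree:ℝ)) + 1) ∧
      x ^ (1 / (F.natDegree:ℝ)) ≤ C1 * (N (polySeq F) x + 1) ∧
      (N (polySeq F) x = 0 ∨ 1 ≤ N (polySeq F) x) ∧
      (∀ d : ℕ, 1 ≤ d → |Nd (polySeq F) d x - (rootCount F d : ℝ) / d * N (polySeq F) x| ≤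
        C1 * (rootCount F d + 1)) ∧
      (∀ d : ℕ, 0 ≤ Nd (polySeq F) d x ∧ Nd (polySeq F) d x ≤ N (polySeq F) x) := by
  obtain ⟨m0, c, B, hc, hB, H⟩ := poly_count F hdeg hlead
  set D := F.natDegree with hD
  have hDpos : (0:ℝ) < D := by exact_mod_cast hdeg
  set θ : ℝ := 1 / (D:ℝ) with hθ
  have hθpos : 0 < θ := by positivity
  have hroot : ∀ y : ℝ, 0 ≤ y → (y ^ D) ^ θ = y := by
    intro y hy
    rw [hθ, one_div]; exact Real.pow_rpow_inv_natCast hy (by omega)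
  have hci : 0 < c⁻¹ ^ θ := by positivity
  have hBi : 0 < B ^ θ := by positivity
  refine ⟨1 + c⁻¹ ^ θ + (2 * m0 + 1) + B ^ θ * (2 * m0 + 2), ?_, ?_⟩
  · have : 0 < B ^ θ * (2 * (m0:ℝ) + 2) := by positivity
    have : (0:ℝ) ≤ m0 := by positivity
    linarith
  intro x hx
  obtain ⟨T, h1, h2, h3⟩ := H x hx
  set C1 : ℝ := 1 + c⁻¹ ^ θ + (2 * m0 + 1) + B ^ θ * (2 * m0 + 2) with hC1
  have hm0 : (0:ℝ) ≤ m0 := by positivity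
  have hT0 : (0:ℝ) ≤ T := by positivity
  have hBm : 0 < B ^ θ * (2 * (m0:ℝ) + 2) := by positivity
  have hxθ : 0 ≤ x ^ θ := by positivity
  have hN := h3 1 le_rfl
  rw [← polyN_eq, rootCount_one] at hN
  simp only [Nat.cast_one, div_one, one_mul] at hN
  have hN' := abs_le.mp hN
  have hNnat : ∃ k : ℕ, N (polySeq F) x = k := ⟨_, by rw [polyN_eq, polyNd_card]⟩
  obtain ⟨k, hk⟩ := hNnat
  have hN0 : 0 ≤ N (polySeq F) x := by rw [hk]; positivity
  refine ⟨?_, ?_, ?_, ?_, ?_⟩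
  · have hT : (T:ℝ) ≤ c⁻¹ ^ θ * x ^ θ := by
      rw [← Real.mul_rpow (by positivity) hx, ← hroot T hT0]
      apply Real.rpow_le_rpow (by positivity) _ hθpos.le
      rw [inv_mul_eq_div, le_div_iff₀ hc]; linarith
    nlinarith [mul_nonneg hm0 hxθ, mul_nonneg hBm.le hxθ]
  · have hx2 : x ^ θ ≤ B ^ θ * (m0 + T) := by
      calc x ^ θ ≤ (B * ((m0:ℝ) + T) ^ D) ^ θ := Real.rpow_le_rpow hx h2 hθpos.le
        _ = _ := by rw [Real.mul_rpow hB.le (by positivity), hroot _ (by positivity)]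
    have hTN : (T:ℝ) ≤ N (polySeq F) x + (1 + m0) := by linarith [hN'.1]
    calc x ^ θ ≤ B ^ θ * (m0 + T) := hx2
      _ ≤ B ^ θ * ((2 * m0 + 2) * (N (polySeq F) x + 1)) := by
          gcongr; nlinarith [mul_nonneg hm0 hN0]
      _ = B ^ θ * (2 * m0 + 2) * (N (polySeq F) x + 1) := by ring
      _ ≤ _ := by gcongr; linarith
  · rw [hk]
    rcases Nat.eq_zero_or_pos k with h | h
    · left; simp [h]
    · right; exact_mod_cast h
  · intro d hd
    have hd3 := h3 d hd
    have hdr : (0:ℝ) < d := by exact_mod_cast hd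
    have hg1 : (rootCount F d : ℝ) / d ≤ 1 := by
      rw [div_le_one hdr]; exact_mod_cast rootCount_le F d
    have hg0 : 0 ≤ (rootCount F d : ℝ) / d := by positivity
    have hh : (0:ℝ) ≤ rootCount F d := by positivity
    have e : Nd (polySeq F) d x - (rootCount F d : ℝ) / d * N (polySeq F) x =
      (Nd (polySeq F) d x - (rootCount F d : ℝ) / d * T) -
        (rootCount F d : ℝ) / d * (N (polySeq F) x - T) := by ring
    rw [e]
    calc _ ≤ |Nd (polySeq F) d x - (rootCount F d : ℝ) / d * T| +
          |(rootCount F d : ℝ) / d * (N (polySeq F) x - T)| := abs_sub _ _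
      _ ≤ (rootCount F d + m0) + 1 * (1 + m0) := by
          rw [abs_mul, abs_of_nonneg hg0]; gcongr
      _ ≤ _ := by nlinarith [mul_nonneg hm0 hh, mul_nonneg hBm.le hh, mul_nonneg hci.le hh]
  · intro d
    rw [polyN_eq, polyNd_card, polyNd_card]
    refine ⟨by positivity, ?_⟩
    norm_cast
    apply Finset.card_le_card
    apply Finset.filter_subset_filter
    intro n; simp; intro a b _; exact ⟨a, b⟩

lemma poly_regular (F : Polynomial ℤ) (hdeg : 1 ≤ F.natDegree) (hlead : 0 < F.leadingCoeff) :
    Regular (polySeq F) := by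
  obtain ⟨C1, hC1, H⟩ := poly_summary F hdeg hlead
  have hDpos : (0:ℝ) < F.natDegree := by exact_mod_cast hdeg
  set θ : ℝ := 1 / (F.natDegree:ℝ) with hθ
  have hθpos : 0 < θ := by positivity
  intro c hc0 hc1
  have s1 : (fun x : ℝ => N (polySeq F) (x ^ c)) =O[atTop] fun x : ℝ => x ^ (c * θ) := by
    apply Asymptotics.IsBigO.of_bound (2 * C1)
    filter_upwards [eventually_ge_atTop 1] with x hx
    have hx0 : 0 ≤ x := by linarith
    obtain ⟨h1, _, _, _, _⟩ := H (x ^ c) (by positivity)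
    have h5 := (H (x ^ c) (by positivity)).2.2.1
    have hN0 : 0 ≤ N (polySeq F) (x ^ c) := by rcases h5 with h | h <;> linarith
    rw [← Real.rpow_mul hx0] at h1
    have h2 : 1 ≤ x ^ (c * θ) := Real.one_le_rpow hx (by positivity)
    rw [Real.norm_of_nonneg hN0, Real.norm_of_nonneg (by linarith)]
    nlinarith
  have s2 : (fun x : ℝ => x ^ (c * θ)) =o[atTop] fun x : ℝ => x ^ θ := by
    have ht : Tendsto (fun x : ℝ => x ^ (-(θ - c * θ))) atTop (nhds 0) :=
      tendsto_rpow_neg_atTop (by nlinarith)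
    rw [Asymptotics.isLittleO_iff_tendsto']
    · apply ht.congr'
      filter_upwards [eventually_gt_atTop 0] with x hx
      rw [← Real.rpow_sub hx]; congr 1; ring
    · filter_upwards [eventually_gt_atTop 0] with x hx h
      have := Real.rpow_pos_of_pos hx θ
      linarith
  have s3 : (fun x : ℝ => x ^ θ) =O[atTop] fun x : ℝ => N (polySeq F) x := by
    apply Asymptotics.IsBigO.of_bound (2 * C1)
    filter_upwards [eventually_ge_atTop 0, (tendsto_rpow_atTop hθpos).eventually_gt_atTop C1]
      with x hx hx2
    obtain ⟨_, h2, h3, _, _⟩ := H x hx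
    have hN : 1 ≤ N (polySeq F) x := by
      rcases h3 with h | h
      · rw [h] at h2; linarith
      · exact h
    rw [Real.norm_of_nonneg (by positivity), Real.norm_of_nonneg (by linarith)]
    nlinarith
  exact (s1.trans_isLittleO s2).trans_isBigO s3

lemma poly_locUnif (F : Polynomial ℤ) (hdeg : 1 ≤ F.natDegree)
    (hirr : Irreducible (F.map (algebraMap ℤ ℚ))) (hlead : 0 < F.leadingCoeff) :
    LocallyUniform (polySeq F) := by
  obtain ⟨C1, hC1, H⟩ := poly_summary F hdeg hlead
  obtain ⟨C, hC, hCb⟩ := rootCount_bound F hirr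
  have hDpos : (0:ℝ) < F.natDegree := by exact_mod_cast hdeg
  have hC' : (1:ℝ) ≤ C := by exact_mod_cast hC
  refine ⟨1 / (F.natDegree:ℝ), by positivity, 0, le_rfl, C, hC', 1 + 4 * C1 ^ 2, ?_⟩
  set θ : ℝ := 1 / (F.natDegree:ℝ) with hθ
  intro x hx d hd hdx
  obtain ⟨_, h2, h3, h4, h5⟩ := H x (by linarith)
  have hdr : (0:ℝ) < d := by exact_mod_cast hd
  rw [Real.rpow_zero, mul_one]
  rcases h3 with h | h
  · have := (h5 d).2
    rw [h] at this ⊢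
    simpa using this
  · have h6 := (abs_le.mp (h4 d hd)).2
    set W : ℝ := (C:ℝ) ^ bigOmega d
    have hW1 : 1 ≤ W := one_le_pow₀ hC'
    have hr : (rootCount F d : ℝ) ≤ W := by
      calc (rootCount F d : ℝ) ≤ (C:ℝ) ^ d.primeFactors.card := by exact_mod_cast hCb d hd
        _ ≤ W := pow_le_pow_right₀ hC' (card_primeFactors_le d)
    set M := N (polySeq F) x
    have hdM : (d:ℝ) ≤ 2 * C1 * M := by nlinarith
    rw [le_div_iff₀ hdr]
    have e : Nd (polySeq F) d x * d ≤ rootCount F d * M + C1 * (rootCount F d + 1) * d := by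
      have h7 : Nd (polySeq F) d x ≤ (rootCount F d : ℝ) / d * M + C1 * (rootCount F d + 1) := by
        linarith
      calc _ ≤ ((rootCount F d : ℝ) / d * M + C1 * (rootCount F d + 1)) * d := by gcongr
        _ = _ := by field_simp
    calc _ ≤ _ := e
      _ ≤ W * M + C1 * (W + W) * (2 * C1 * M) := by gcongr
      _ = _ := by ring

lemma poly_level (F : Polynomial ℤ) (hdeg : 1 ≤ F.natDegree)
    (hirr : Irreducible (F.map (algebraMap ℤ ℚ))) (hlead : 0 < F.leadingCoeff) :
    HasLevel (polySeq F) (1 / (F.natDegree : ℝ)) (fun d => (rootCount F d : ℝ) / d) := by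
  obtain ⟨C1, hC1, H⟩ := poly_summary F hdeg hlead
  obtain ⟨C, hC, hCb⟩ := rootCount_bound F hirr
  have hDpos : (0:ℝ) < F.natDegree := by exact_mod_cast hdeg
  have hC' : (1:ℝ) ≤ C := by exact_mod_cast hC
  refine ⟨⟨by simp [rootCount_one], ?_⟩, ?_, poly_mertens F hdeg hirr, ⟨C, hC', 1, ?_⟩, ?_⟩
  · intro m n hmn
    simp only [rootCount_mul F m n hmn]
    push_cast
    rw [mul_div_mul_comm]
  · intro d hd
    have hdr : (0:ℝ) < d := by exact_mod_cast hd
    refine ⟨by positivity, ?_⟩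
    simp only
    rw [div_le_one hdr]; exact_mod_cast rootCount_le F d
  · intro d hd
    simp only [one_mul]
    gcongr
    calc (rootCount F d : ℝ) ≤ (C:ℝ) ^ d.primeFactors.card := by exact_mod_cast hCb d hd
      _ ≤ _ := pow_le_pow_right₀ hC' (card_primeFactors_le d)
  set θ : ℝ := 1 / (F.natDegree:ℝ) with hθ
  intro c hc hcθ A hA
  set ε : ℝ := (θ - c) / (2 * c) with hε
  have hεpos : 0 < ε := by have : 0 < θ - c := by linarith
                           positivity
  obtain ⟨K0, hK0, hK⟩ := pow_omega_le C hC ε hεpos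
  set s : ℝ := (θ - c) / (2 * A) with hs
  have hspos : 0 < s := by have : 0 < θ - c := by linarith
                           positivity
  refine ⟨4 * C1 ^ 2 * K0 * (1 / s) ^ A, ?_⟩
  intro x hx
  have hx0 : 0 < x := by linarith
  obtain ⟨_, h2, h3, h4, h5⟩ := H x hx0.le
  rcases h3 with h | h
  · rw [h]
    simp only [mul_zero, zero_div, sub_zero]
    apply le_of_eq
    apply Finset.sum_eq_zero
    intro d _
    have := h5 d
    rw [h] at this
    rw [le_antisymm this.2 this.1, abs_zero]
  · set M := N (polySeq F) x
    have hlog : 0 < Real.log x := Real.log_pos (by linarith)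
    have hxM : x ^ θ ≤ 2 * C1 * M := by nlinarith
    set y := x ^ c with hy
    have hy0 : 0 < y := by positivity
    have t1 : ∑ d ∈ Finset.Icc 1 ⌊y⌋₊, |Nd (polySeq F) d x - (rootCount F d : ℝ) / d * M| ≤
        y * (2 * C1 * K0 * y ^ ε) := by
      calc _ ≤ ∑ d ∈ Finset.Icc 1 ⌊y⌋₊, 2 * C1 * K0 * y ^ ε := by
            apply Finset.sum_le_sum
            intro d hd
            rw [Finset.mem_Icc] at hd
            have hdy : (d:ℝ) ≤ y := (Nat.le_floor_iff hy0.le).mp hd.2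
            have hd1 : (1:ℝ) ≤ d := by exact_mod_cast hd.1
            have hr : (rootCount F d : ℝ) ≤ K0 * y ^ ε := by
              calc (rootCount F d : ℝ) ≤ (C:ℝ) ^ d.primeFactors.card := by
                    exact_mod_cast hCb d hd.1
                _ ≤ K0 * (d:ℝ) ^ ε := hK d hd.1
                _ ≤ _ := by gcongr
            have h1 : 1 ≤ K0 * y ^ ε := by
              have : 1 ≤ y ^ ε := Real.one_le_rpow (hd1.trans hdy) hεpos.le
              nlinarith
            calc _ ≤ C1 * (rootCount F d + 1) := h4 d hd.1
              _ ≤ C1 * (K0 * y ^ ε + K0 * y ^ ε) := by gcongr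
              _ = _ := by ring
        _ = (⌊y⌋₊ : ℝ) * (2 * C1 * K0 * y ^ ε) := by
            rw [Finset.sum_const, Nat.card_Icc, nsmul_eq_mul]; simp
        _ ≤ _ := by gcongr; exact Nat.floor_le hy0.le
    have t2 : y * y ^ ε = x ^ ((c + θ) / 2) := by
      rw [hy, ← Real.rpow_mul hx0.le, ← Real.rpow_add hx0]
      congr 1; rw [hε]; field_simp; ring
    have t3 : Real.log x ^ A ≤ (1 / s) ^ A * x ^ ((θ - c) / 2) := by
      calc Real.log x ^ A ≤ (x ^ s / s) ^ A :=
            Real.rpow_le_rpow hlog.le (Real.log_le_rpow_div hx0.le hspos) hA.le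
        _ = ((1 / s) * x ^ s) ^ A := by congr 1; ring
        _ = (1 / s) ^ A * x ^ (s * A) := by
            rw [Real.mul_rpow (by positivity) (by positivity), ← Real.rpow_mul hx0.le]
        _ = _ := by congr 2; rw [hs]; field_simp
    have t4 : x ^ ((c + θ) / 2) * x ^ ((θ - c) / 2) = x ^ θ := by
      rw [← Real.rpow_add hx0]; congr 1; ring
    rw [le_div_iff₀ (by positivity)]
    calc _ ≤ y * (2 * C1 * K0 * y ^ ε) * ((1 / s) ^ A * x ^ ((θ - c) / 2)) := by gcongr
      _ = 2 * C1 * K0 * (1 / s) ^ A * ((y * y ^ ε) * x ^ ((θ - c) / 2)) := by ring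
      _ = 2 * C1 * K0 * (1 / s) ^ A * x ^ θ := by rw [t2, t4]
      _ ≤ 2 * C1 * K0 * (1 / s) ^ A * (2 * C1 * M) := by gcongr
      _ = _ := by ring

/-- values of an irreducible polynomial `F` of degree `D ≥ 1` with positive
leading coefficient are regular, have level of distribution `1/D` with density
`g(d) = h(d)/d` (`h(d)` the number of roots of `F` mod `d`), and are locally uniform. -/
theorem polyValues_regular_level_locallyUniform (F : Polynomial ℤ)
    (hdeg : 1 ≤ F.natDegree) (hirr : Irreducible (F.map (algebraMap ℤ ℚ)))
    (hlead : 0 < F.leadingCoeff) :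
    let seq : ℕ → ℝ :=
      fun n => if 1 ≤ n ∧ ∃ m : ℕ, 1 ≤ m ∧ F.eval (m : ℤ) = (n : ℤ) then 1 else 0
    Regular seq ∧
    HasLevel seq (1 / (F.natDegree : ℝ)) (fun d => (rootCount F d : ℝ) / d) ∧
    LocallyUniform seq :=
  ⟨poly_regular F hdeg hlead, poly_level F hdeg hirr hlead, poly_locUnif F hdeg hirr hlead⟩
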